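/- There exists a constant C > 0 depending only on a, b and β such that for every Lipschitz V : closure(Ω) → ℝ with a ≤ V ≤ b and Lipschitz constant ‖∇V‖_∞ ≤ a/(2(1+2^{2β})), and every classical solution u of problem (P) relative to V, one has ∫_{C₂} (2 + 2(β+1)|x-x₀|^{2β}) V(x) e^{u(x)} dx ≤ C and |∫_{C(1/2)} ∂_ν u dσ| ≤ C, where C₂ = {x ∈ ℝ² : 1/2 < |x| < 3/4}, ν(x) = -2x is the outward unit normal of Ω on the inner circle C(1/2), ∂_ν u = ∇u·ν, and dσ is arc-length measure. -/

import Mathlib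

open MeasureTheory Real RealInnerProductSpace

noncomputable section

/-- The Euclidean plane ℝ². -/
abbrev E2 := EuclideanSpace ℝ (Fin 2)

/-- The open annulus `{x : R₂ < |x| < R₁}` centered at the origin. -/
def ann (R₂ R₁ : ℝ) : Set E2 := {x : E2 | R₂ < ‖x‖ ∧ ‖x‖ < R₁}

/-- `Ω`, the open annulus of radii 1/2 and 1 centered at the origin. -/
def Omega : Set E2 := ann (1/2) 1

/-- The Laplacian `Δ = ∂₁₁ + ∂₂₂` on ℝ². -/
def lap (u : E2 → ℝ) (x : E2) : ℝ :=
  ∑ i : Fin 2,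
    iteratedFDeriv ℝ 2 u x ![EuclideanSpace.single i 1, EuclideanSpace.single i 1]

/-- The point `r (cos θ, sin θ)` on the circle of radius `r`. -/
def circlePt (r θ : ℝ) : E2 :=
  (WithLp.equiv 2 (Fin 2 → ℝ)).symm ![r * Real.cos θ, r * Real.sin θ]

/-- Arc-length integral of `f` over the circle `C(r) = {x : |x| = r}` centered at the origin:
`∫_{C(r)} f dσ = ∫_0^{2π} f(r cos θ, r sin θ) r dθ`. -/
def circleIntR (f : E2 → ℝ) (r : ℝ) : ℝ := ∫ θ in (0:ℝ)..(2 * π), f (circlePt r θ) * r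

/-- A classical solution of problem (P): `u ∈ C²(closure Ω)`, `u = 0` on `∂Ω`, and
`-Δu = (1 + |x - x₀|^{2β}) V e^u` in `Ω`. -/
def IsSolP (β : ℝ) (x₀ : E2) (V u : E2 → ℝ) : Prop :=
  ContDiffOn ℝ 2 u (closure Omega) ∧
  (∀ x ∈ frontier Omega, u x = 0) ∧
  ∀ x ∈ Omega, -lap u x = (1 + ‖x - x₀‖ ^ (2 * β)) * V x * Real.exp (u x)

/-- A classical solution of problem (P_β): `u ∈ C²(closure Ω)`, `u = 0` on `∂Ω`, and
`-Δu = |x - x₀|^{2β} V e^u` in `Ω`. -/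
def IsSolPbeta (β : ℝ) (x₀ : E2) (V u : E2 → ℝ) : Prop :=
  ContDiffOn ℝ 2 u (closure Omega) ∧
  (∀ x ∈ frontier Omega, u x = 0) ∧
  ∀ x ∈ Omega, -lap u x = ‖x - x₀‖ ^ (2 * β) * V x * Real.exp (u x)

/-- standard basis vector -/
def ee (i : Fin 2) : E2 := EuclideanSpace.single i 1

/-- partial derivative -/
def D (i : Fin 2) (v : E2 → ℝ) (x : E2) : ℝ := fderiv ℝ v x (ee i)

lemma D_cont {v : E2 → ℝ} (hv : ContDiff ℝ 1 v) (i : Fin 2) : Continuous (D i v) := by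
  unfold D
  have := hv.continuous_fderiv (by norm_num)
  fun_prop

lemma D_contDiff {v : E2 → ℝ} (hv : ContDiff ℝ 2 v) (i : Fin 2) : ContDiff ℝ 1 (D i v) := by
  unfold D
  have : ContDiff ℝ 1 (fderiv ℝ v) := hv.fderiv_right (by norm_num)
  exact this.clm_apply contDiff_const

lemma D_mul {f g : E2 → ℝ} {x : E2} (hf : DifferentiableAt ℝ f x) (hg : DifferentiableAt ℝ g x)
    (i : Fin 2) : D i (fun y => f y * g y) x = D i f x * g x + f x * D i g x := by
  unfold D
  rw [fderiv_fun_mul hf hg]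
  simp; ring

lemma D_add {f g : E2 → ℝ} {x : E2} (hf : DifferentiableAt ℝ f x) (hg : DifferentiableAt ℝ g x)
    (i : Fin 2) : D i (fun y => f y + g y) x = D i f x + D i g x := by
  unfold D
  rw [fderiv_fun_add hf hg]
  simp

lemma D_sub {f g : E2 → ℝ} {x : E2} (hf : DifferentiableAt ℝ f x) (hg : DifferentiableAt ℝ g x)
    (i : Fin 2) : D i (fun y => f y - g y) x = D i f x - D i g x := by
  unfold D
  rw [fderiv_fun_sub hf hg]
  simp

/-- chain rule -/
lemma D_comp {f : E2 → ℝ} {g : ℝ → ℝ} {g' : ℝ} {x : E2} (hf : DifferentiableAt ℝ f x)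
    (hg : HasDerivAt g g' (f x)) (i : Fin 2) : D i (fun y => g (f y)) x = g' * D i f x := by
  unfold D
  have := hg.comp_hasFDerivAt x hf.hasFDerivAt
  have h2 : fderiv ℝ (fun y => g (f y)) x = g' • fderiv ℝ f x := this.fderiv
  rw [h2]; simp

lemma D_const (c : ℝ) (i : Fin 2) (x : E2) : D i (fun _ => c) x = 0 := by
  simp [D]

lemma D_congr {f g : E2 → ℝ} {x : E2} (h : f =ᶠ[nhds x] g) (i : Fin 2) : D i f x = D i g x := by
  unfold D; rw [h.fderiv_eq]

lemma D_coord (i j : Fin 2) (x : E2) : D i (fun y => y j) x = if i = j then 1 else 0 := by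
  unfold D
  have : HasFDerivAt (fun y : E2 => y j) (EuclideanSpace.proj j : E2 →L[ℝ] ℝ) x :=
    (EuclideanSpace.proj j : E2 →L[ℝ] ℝ).hasFDerivAt
  rw [this.fderiv]
  simp [ee]
  by_cases h : i = j <;> simp [h, eq_comm]

lemma D_supp {f : E2 → ℝ} {x : E2} (h : x ∉ tsupport f) (i : Fin 2) : D i f x = 0 := by
  have : f =ᶠ[nhds x] fun _ => 0 := by
    have := notMem_tsupport_iff_eventuallyEq.1 h
    exact this
  rw [D_congr this, D_const]

lemma hcs_D {f : E2 → ℝ} (h : HasCompactSupport f) (i : Fin 2) : HasCompactSupport (D i f) :=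
  h.mono' (by
    intro x hx
    by_contra hc
    exact hx (D_supp hc i))

lemma int_D_zero {F : E2 → ℝ} (hF : ContDiff ℝ 1 F) (hc : HasCompactSupport F) (i : Fin 2) :
    ∫ x, D i F x = 0 := by
  have h1 : Integrable (D i F) := (D_cont hF i).integrable_of_hasCompactSupport (hcs_D hc i)
  have h1q : Integrable (fun x => fderiv ℝ F x (ee i)) := h1
  have h2 : Integrable F := hF.continuous.integrable_of_hasCompactSupport hc
  have := integral_mul_fderiv_eq_neg_fderiv_mul_of_integrable (μ := (volume : Measure E2))
    (f := fun _ : E2 => (1:ℝ)) (g := F) (v := ee i) (by simp)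
    (by simpa using h1q) (by simpa using h2) (fun x _ => by fun_prop)
    (fun x _ => (hF.differentiable (by norm_num)) x)
  simpa [D] using this

lemma int_div_zero {F G : E2 → ℝ} (hF : ContDiff ℝ 1 F) (hc : HasCompactSupport F)
    (hG : ContDiff ℝ 1 G) (hcG : HasCompactSupport G) :
    ∫ x, (D 0 F x + D 1 G x) = 0 := by
  have h1 : Integrable (D 0 F) := (D_cont hF 0).integrable_of_hasCompactSupport (hcs_D hc 0)
  have h2 : Integrable (D 1 G) := (D_cont hG 1).integrable_of_hasCompactSupport (hcs_D hcG 1)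
  rw [integral_add h1 h2, int_D_zero hF hc, int_D_zero hG hcG, add_zero]

/-- second derivatives commute, and the Laplacian in terms of `D`. -/
lemma D_D {v : E2 → ℝ} {x : E2} (hv : ContDiffAt ℝ 2 v x) (i j : Fin 2) :
    D i (D j v) x = fderiv ℝ (fderiv ℝ v) x (ee i) (ee j) := by
  have h1 : ContDiffAt ℝ 1 (fderiv ℝ v) x := hv.fderiv_right (by norm_num)
  have h2 : DifferentiableAt ℝ (fderiv ℝ v) x := h1.differentiableAt (by norm_num)
  show fderiv ℝ (fun y => fderiv ℝ v y (ee j)) x (ee i) = _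
  rw [fderiv_clm_apply h2 (differentiableAt_const _)]
  simp

lemma D_symm {v : E2 → ℝ} {x : E2} (hv : ContDiffAt ℝ 2 v x) (i j : Fin 2) :
    D i (D j v) x = D j (D i v) x := by
  rw [D_D hv, D_D hv]
  exact hv.isSymmSndFDerivAt (by simp) (ee i) (ee j)

lemma lap_eq {v : E2 → ℝ} {x : E2} (hv : ContDiffAt ℝ 2 v x) :
    lap v x = D 0 (D 0 v) x + D 1 (D 1 v) x := by
  unfold lap
  rw [D_D hv, D_D hv]
  simp [Fin.sum_univ_two, iteratedFDeriv_two_apply, ee]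

lemma lap_cont {v : E2 → ℝ} (hv : ContDiff ℝ 2 v) : Continuous (lap v) := by
  have : lap v = fun x => D 0 (D 0 v) x + D 1 (D 1 v) x := by
    funext x; exact lap_eq hv.contDiffAt
  rw [this]
  exact (D_cont (D_contDiff hv 0) 0).add (D_cont (D_contDiff hv 1) 1)

/-- weak formulation -/
lemma weak {v G : E2 → ℝ} (hv : ContDiff ℝ 2 v) (hG : ContDiff ℝ 1 G) (hc : HasCompactSupport G) :
    ∫ x, (-lap v x) * G x = ∫ x, (D 0 v x * D 0 G x + D 1 v x * D 1 G x) := by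
  have c0 := D_contDiff hv 0
  have c1 := D_contDiff hv 1
  have h := int_div_zero (F := fun x => D 0 v x * G x) (G := fun x => D 1 v x * G x)
    (c0.mul hG) hc.mul_left (c1.mul hG) hc.mul_left
  have hGd := hG.differentiable (by norm_num)
  have e : ∀ x, D 0 (fun x => D 0 v x * G x) x + D 1 (fun x => D 1 v x * G x) x
      = (D 0 v x * D 0 G x + D 1 v x * D 1 G x) - (-lap v x) * G x := by
    intro x
    rw [D_mul (c0.differentiable (by norm_num) x) (hGd x),
      D_mul (c1.differentiable (by norm_num) x) (hGd x), lap_eq hv.contDiffAt]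
    ring
  simp_rw [e] at h
  rw [integral_sub] at h
  · linarith
  · apply Continuous.integrable_of_hasCompactSupport
    · have := D_cont hG 0
      have := D_cont hG 1
      have := c0.continuous
      have := c1.continuous
      fun_prop
    · exact ((hcs_D hc 0).mul_left).add ((hcs_D hc 1).mul_left)
  · apply Continuous.integrable_of_hasCompactSupport
    · have := lap_cont hv
      have := hG.continuous
      fun_prop
    · exact hc.mul_left


lemma cube_le_exp {t : ℝ} (ht : 0 ≤ t) : (1 + t) ^ 3 ≤ 18 * Real.exp t := by
  have h := Real.pow_div_factorial_le_exp (1 + t) (by linarith) 3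
  rw [Real.exp_add] at h
  have h1 := Real.exp_one_lt_d9
  have h2 := Real.exp_pos t
  norm_num [Nat.factorial] at h
  nlinarith

/-- Interior mass bound. -/
lemma mass_bound {v φ : E2 → ℝ} {a K P : ℝ} (ha : 0 < a) (hv : ContDiff ℝ 2 v) (hv0 : ∀ x, 0 ≤ v x)
    (hφ : ContDiff ℝ 1 φ) (hc : HasCompactSupport φ) (h0 : ∀ x, 0 ≤ φ x) (h1 : ∀ x, φ x ≤ 1)
    (hK0 : 0 ≤ K) (hK : ∀ x, D 0 φ x ^ 2 + D 1 φ x ^ 2 ≤ K)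
    (hP : ∫ x, (D 0 φ x ^ 2 + D 1 φ x ^ 2) ≤ P)
    (heq : ∀ x, φ x ≠ 0 → a * Real.exp (v x) ≤ -lap v x) :
    a * ∫ x, φ x ^ 4 * Real.exp (v x) ≤ 4 * P + 72 * K / a * (2 * P) := by
  have vd := hv.differentiable (by norm_num)
  have vc := hv.continuous
  have φd := hφ.differentiable (by norm_num)
  have φc := hφ.continuous
  have lc := lap_cont hv
  have p0 := (D_contDiff hv 0).continuous
  have p1 := (D_contDiff hv 1).continuous
  have f0 := D_cont hφ 0
  have f1 := D_cont hφ 1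
  have hne : ∀ x, 1 + v x ≠ 0 := fun x => by have := hv0 x; positivity
  -- zero off the support
  have hz : ∀ x, x ∉ tsupport φ → φ x = 0 ∧ D 0 φ x = 0 ∧ D 1 φ x = 0 := fun x hx =>
    ⟨image_eq_zero_of_notMem_tsupport hx, D_supp hx 0, D_supp hx 1⟩
  have key : ∀ g : E2 → ℝ, Continuous g → (∀ x, φ x = 0 → D 0 φ x = 0 → D 1 φ x = 0 → g x = 0) →
      Integrable g := by
    intro g hg h
    apply hg.integrable_of_hasCompactSupport
    apply HasCompactSupport.intro (K := tsupport φ) hc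
    intro x hx
    obtain ⟨a1, a2, a3⟩ := hz x hx
    exact h x a1 a2 a3
  -- step 1
  have w1 := weak hv (G := fun x => φ x ^ 2 * (1 + v x)⁻¹)
    ((hφ.pow 2).mul ((contDiff_const.add (hv.of_le (by norm_num))).inv hne))
    ((hc.comp_left (g := fun t => t ^ 2) (by norm_num)).mul_right)
  have e1 : ∀ i x, D i (fun x => φ x ^ 2 * (1 + v x)⁻¹) x
      = 2 * φ x * D i φ x * (1 + v x)⁻¹ - φ x ^ 2 * (D i v x * ((1 + v x)⁻¹) ^ 2) := by
    intro i x
    have hd : DifferentiableAt ℝ (fun x => (1 + v x)⁻¹) x := by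
      have := vd x
      have := hne x
      fun_prop (disch := assumption)
    rw [D_mul (by have := φd x; fun_prop) hd]
    rw [D_comp (g := fun t => t ^ 2) (φd x) (hasDerivAt_pow 2 _)]
    rw [D_comp (f := v) (g := fun t => (1 + t)⁻¹) (g' := -1 / (1 + v x) ^ 2) (vd x)]
    · simp; field_simp; ring
    · exact HasDerivAt.inv ((hasDerivAt_id _).const_add 1) (hne x)
  simp_rw [e1] at w1
  have hinv : Continuous fun x => (1 + v x)⁻¹ := by
    have := hne
    fun_prop (disch := assumption)
  have iA : Integrable fun x => -lap v x * (φ x ^ 2 * (1 + v x)⁻¹) :=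
    key _ (by fun_prop) (by intro x h _ _; simp [h])
  have iB : Integrable fun x => (D 0 v x ^ 2 + D 1 v x ^ 2) * φ x ^ 2 * ((1 + v x)⁻¹) ^ 2 :=
    key _ (by fun_prop) (by intro x h _ _; simp [h])
  have iC : Integrable fun x => (D 0 φ x ^ 2 + D 1 φ x ^ 2) :=
    key _ (by fun_prop) (by intro x h h' h''; simp [h', h''])
  have s1 : ∫ x, -lap v x * (φ x ^ 2 * (1 + v x)⁻¹) ≤
      ∫ x, (2 * (D 0 φ x ^ 2 + D 1 φ x ^ 2)
        - (1/2) * ((D 0 v x ^ 2 + D 1 v x ^ 2) * φ x ^ 2 * ((1 + v x)⁻¹) ^ 2)) := by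
    rw [w1]
    apply integral_mono
    · exact key _ (by fun_prop) (by intro x h h' h''; simp [h])
    · exact (iC.const_mul 2).sub (iB.const_mul _)
    · intro x
      simp only
      nlinarith [sq_nonneg (D 0 v x * φ x * (1 + v x)⁻¹ - 2 * D 0 φ x),
        sq_nonneg (D 1 v x * φ x * (1 + v x)⁻¹ - 2 * D 1 φ x)]
  rw [integral_sub (iC.const_mul 2) (iB.const_mul _), integral_const_mul, integral_const_mul] at s1
  have hA0 : 0 ≤ ∫ x, -lap v x * (φ x ^ 2 * (1 + v x)⁻¹) := by
    apply integral_nonneg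
    intro x
    by_cases h : φ x = 0
    · simp [h]
    · have := heq x h
      have := hv0 x
      have : 0 ≤ -lap v x := le_trans (by positivity) (heq x h)
      positivity
  have hB0 : 0 ≤ ∫ x, (D 0 v x ^ 2 + D 1 v x ^ 2) * φ x ^ 2 * ((1 + v x)⁻¹) ^ 2 := by
    apply integral_nonneg
    intro x
    positivity
  -- step 2
  have w2 := weak hv (G := fun x => φ x ^ 4) (hφ.pow 4)
    (hc.comp_left (g := fun t => t ^ 4) (by norm_num))
  have e2 : ∀ i x, D i (fun x => φ x ^ 4) x = 4 * φ x ^ 3 * D i φ x := by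
    intro i x
    rw [D_comp (g := fun t => t ^ 4) (φd x) (hasDerivAt_pow 4 _)]
    simp
  simp_rw [e2] at w2
  have s2 : ∫ x, -lap v x * φ x ^ 4 ≤
      ∫ x, ((D 0 v x ^ 2 + D 1 v x ^ 2) * φ x ^ 2 * ((1 + v x)⁻¹) ^ 2 +
        72 * K / a * (-lap v x * (φ x ^ 2 * (1 + v x)⁻¹))) := by
    rw [w2]
    apply integral_mono
    · exact key _ (by fun_prop) (by intro x h h' h''; simp [h])
    · exact iB.add (iA.const_mul _)
    · intro x
      simp only
      by_cases h : φ x = 0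
      · simp [h]
      have hpos : 0 < φ x := lt_of_le_of_ne (h0 x) (Ne.symm h)
      have hvx := hv0 x
      set t := 1 + v x with ht
      have htp : 0 < t := by positivity
      have b1 : ∀ p q : ℝ, p * (4 * φ x ^ 3 * q) ≤ p ^ 2 * φ x ^ 2 * (t⁻¹) ^ 2
          + 4 * t ^ 2 * φ x ^ 2 * q ^ 2 := by
        intro p q
        have h4 : φ x ^ 4 ≤ φ x ^ 2 := pow_le_pow_of_le_one (h0 x) (h1 x) (by norm_num)
        have : p * (4 * φ x ^ 3 * q) ≤ p ^ 2 * φ x ^ 4 * (t⁻¹) ^ 2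
          + 4 * t ^ 2 * φ x ^ 2 * q ^ 2 := by
          have h5 := sq_nonneg (p * φ x ^ 2 * t⁻¹ - 2 * t * φ x * q)
          have h6 : t⁻¹ * t = 1 := inv_mul_cancel₀ htp.ne'
          have : (p * φ x ^ 2 * t⁻¹ - 2 * t * φ x * q) ^ 2 = p ^ 2 * φ x ^ 4 * (t⁻¹) ^ 2
          + 4 * t ^ 2 * φ x ^ 2 * q ^ 2 - 4 * (t⁻¹ * t) * p * φ x ^ 3 * q := by ring
          rw [this, h6] at h5
          linarith
        have h7 : p ^ 2 * φ x ^ 4 * (t⁻¹) ^ 2 ≤ p ^ 2 * φ x ^ 2 * (t⁻¹) ^ 2 := by gcongr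
        linarith
      have b2 : 4 * t ^ 2 * φ x ^ 2 * (D 0 φ x ^ 2 + D 1 φ x ^ 2) ≤
          72 * K / a * (-lap v x * (φ x ^ 2 * t⁻¹)) := by
        have c1 : t ^ 3 ≤ 18 * (-lap v x / a) := by
          refine (cube_le_exp hvx).trans ?_
          gcongr
          rw [le_div_iff₀ ha]; linarith [heq x h]
        have c2 : t ^ 2 = t ^ 3 * t⁻¹ := by field_simp
        calc 4 * t ^ 2 * φ x ^ 2 * (D 0 φ x ^ 2 + D 1 φ x ^ 2)
            ≤ 4 * t ^ 2 * φ x ^ 2 * K := by gcongr; exact hK x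
          _ = 4 * (t ^ 3 * t⁻¹) * φ x ^ 2 * K := by rw [← c2]
          _ ≤ 4 * ((18 * (-lap v x / a)) * t⁻¹) * φ x ^ 2 * K := by gcongr
          _ = _ := by ring
      have := b1 (D 0 v x) (D 0 φ x)
      have := b1 (D 1 v x) (D 1 φ x)
      nlinarith
  rw [integral_add iB (iA.const_mul _), integral_const_mul] at s2
  have s3 : a * ∫ x, φ x ^ 4 * Real.exp (v x) ≤ ∫ x, -lap v x * φ x ^ 4 := by
    rw [← integral_const_mul]
    apply integral_mono
    · exact key _ (by fun_prop) (by intro x h h' h''; simp [h])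
    · exact key _ (by fun_prop) (by intro x h h' h''; simp [h])
    · intro x
      simp only
      by_cases h : φ x = 0
      · simp [h]
      have := heq x h
      have : 0 ≤ φ x ^ 4 := by have := h0 x; positivity
      nlinarith
  have hA1 : ∫ x, -lap v x * (φ x ^ 2 * (1 + v x)⁻¹) ≤ 2 * P := by linarith
  have hB1 : ∫ x, (D 0 v x ^ 2 + D 1 v x ^ 2) * φ x ^ 2 * ((1 + v x)⁻¹) ^ 2 ≤ 4 * P := by linarith
  have : 72 * K / a * ∫ x, -lap v x * (φ x ^ 2 * (1 + v x)⁻¹) ≤ 72 * K / a * (2 * P) := by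
    gcongr
  linarith


lemma norm_fderiv_le_D (w : E2 → ℝ) (x : E2) : ‖fderiv ℝ w x‖ ≤ |D 0 w x| + |D 1 w x| := by
  apply ContinuousLinearMap.opNorm_le_bound _ (by positivity)
  intro y
  have hy : y = y 0 • ee 0 + y 1 • ee 1 := by
    ext i; fin_cases i <;> simp [ee]
  have h0 : |y 0| ≤ ‖y‖ := by simpa using PiLp.norm_apply_le y 0
  have h1 : |y 1| ≤ ‖y‖ := by simpa using PiLp.norm_apply_le y 1
  have : fderiv ℝ w x y = y 0 * D 0 w x + y 1 * D 1 w x := by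
    conv_lhs => rw [hy]
    simp [D]
  rw [this, Real.norm_eq_abs]
  calc |y 0 * D 0 w x + y 1 * D 1 w x| ≤ |y 0| * |D 0 w x| + |y 1| * |D 1 w x| := by
        rw [← abs_mul, ← abs_mul]; exact abs_add_le _ _
    _ ≤ ‖y‖ * |D 0 w x| + ‖y‖ * |D 1 w x| := by gcongr
    _ = _ := by ring

lemma sobolev_aux : ∃ C : NNReal, ∀ w : E2 → ℝ, ContDiff ℝ 1 w → HasCompactSupport w →
      ∫⁻ x, ‖w x‖ₑ ^ (2:ℝ) ≤ C * (∫⁻ x, ‖fderiv ℝ w x‖ₑ) ^ (2:ℝ) := by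
  have hp : Real.HolderConjugate (Module.finrank ℝ E2) 2 := by
    rw [finrank_euclideanSpace_fin]
    exact Real.HolderConjugate.two_two
  exact ⟨lintegralPowLePowLIntegralFDerivConst (volume : Measure E2) 2,
    fun w hw hc => lintegral_pow_le_pow_lintegral_fderiv (μ := (volume : Measure E2)) hw hc hp⟩

lemma sobolev : ∃ S : ℝ, 0 < S ∧ ∀ w : E2 → ℝ, ContDiff ℝ 1 w → HasCompactSupport w →
    ∫ x, w x ^ 2 ≤ S * (∫ x, (|D 0 w x| + |D 1 w x|)) ^ 2 := by
  obtain ⟨C, hC⟩ := sobolev_aux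
  refine ⟨C + 1, by positivity, ?_⟩
  intro w hw hc
  have h := hC w hw hc
  have wc := hw.continuous
  have i1 : Integrable fun x => w x ^ 2 := by
    have hcc : HasCompactSupport fun x => w x ^ 2 :=
      hc.comp_left (g := fun t => t ^ 2) (by norm_num)
    exact Continuous.integrable_of_hasCompactSupport (by fun_prop) hcc
  have fc : Continuous fun x => ‖fderiv ℝ w x‖ := (hw.continuous_fderiv (by norm_num)).norm
  have i2 : Integrable fun x => ‖fderiv ℝ w x‖ :=
    fc.integrable_of_hasCompactSupport (hc.fderiv ℝ).norm
  have i3 : Integrable fun x => (|D 0 w x| + |D 1 w x|) := by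
    have a0 : Integrable (D 0 w) :=
      (D_cont hw 0).integrable_of_hasCompactSupport (hcs_D hc 0)
    have a1 : Integrable (D 1 w) :=
      (D_cont hw 1).integrable_of_hasCompactSupport (hcs_D hc 1)
    exact a0.abs.add a1.abs
  have e1 : ∫⁻ x, ‖w x‖ₑ ^ (2:ℝ) = ENNReal.ofReal (∫ x, w x ^ 2) := by
    rw [ofReal_integral_eq_lintegral_ofReal i1 (Filter.Eventually.of_forall fun x => sq_nonneg _)]
    congr 1; funext x
    rw [← sq_abs, ENNReal.ofReal_pow (abs_nonneg _), Real.enorm_eq_ofReal_abs, ENNReal.rpow_two]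
  have e2 : ∫⁻ x, ‖fderiv ℝ w x‖ₑ = ENNReal.ofReal (∫ x, ‖fderiv ℝ w x‖) := by
    rw [ofReal_integral_eq_lintegral_ofReal i2 (Filter.Eventually.of_forall fun x => norm_nonneg _)]
    simp only [ofReal_norm]
  rw [e1, e2] at h
  have hn : 0 ≤ ∫ x, ‖fderiv ℝ w x‖ := integral_nonneg fun x => norm_nonneg _
  rw [ENNReal.ofReal_rpow_of_nonneg hn (by norm_num), ← ENNReal.ofReal_coe_nnreal,
    ← ENNReal.ofReal_mul (by positivity), ENNReal.ofReal_le_ofReal_iff (by positivity)] at h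
  have h2 : ∫ x, ‖fderiv ℝ w x‖ ≤ ∫ x, (|D 0 w x| + |D 1 w x|) :=
    integral_mono i2 i3 fun x => norm_fderiv_le_D w x
  have h3 : (∫ x, ‖fderiv ℝ w x‖) ^ (2:ℝ) ≤ (∫ x, (|D 0 w x| + |D 1 w x|)) ^ 2 := by
    rw [Real.rpow_two]
    gcongr
  refine h.trans ?_
  have hC : (0:ℝ) ≤ C := C.coe_nonneg
  have := sq_nonneg (∫ x, (|D 0 w x| + |D 1 w x|))
  nlinarith

lemma cs_real {I m E : ℝ} (hm : 0 < m) (hI : 0 ≤ I)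
    (h : ∀ l > 0, 2 * I ≤ l * m + E / l) : I ^ 2 ≤ m * E := by
  rcases hI.eq_or_lt with h0 | h0
  · subst h0
    have hE : 0 ≤ E := by
      by_contra hE
      push Not at hE
      have := h (Real.sqrt (-E / m)) (by apply Real.sqrt_pos.2; apply div_pos <;> linarith)
      set l := Real.sqrt (-E / m) with hl
      have hl0 : 0 < l := by apply Real.sqrt_pos.2; apply div_pos <;> linarith
      have h2 := h (l/2) (by positivity)
      have hl2 : l ^ 2 = -E / m := Real.sq_sqrt (by apply div_nonneg <;> linarith)
      have hE2 : E = - (l ^ 2 * m) := by rw [hl2]; field_simp; 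
      rw [hE2] at h2
      have : -(l ^ 2 * m) / (l/2) = - (2 * l * m) := by field_simp
      rw [this] at h2
      nlinarith [mul_pos hl0 hm]
    have := mul_nonneg hm.le hE
    simpa using this
  · have := h (I / m) (by positivity)
    have e : I / m * m + E / (I / m) = I + E * m / I := by field_simp
    rw [e] at this
    have h3 : I ≤ E * m / I := by linarith
    rw [le_div_iff₀ h0] at h3
    nlinarith

/-- epsilon regularity -/
lemma eps_reg {S : ℝ} (hS : 0 < S) (hSob : ∀ w : E2 → ℝ, ContDiff ℝ 1 w → HasCompactSupport w →
    ∫ x, w x ^ 2 ≤ S * (∫ x, (|D 0 w x| + |D 1 w x|)) ^ 2)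
    {v ψ : E2 → ℝ} {b K m : ℝ} (hb : 0 < b) (hm : 0 < m)
    (hv : ContDiff ℝ 2 v)
    (hψ : ContDiff ℝ 1 ψ) (hc : HasCompactSupport ψ) (h0 : ∀ x, 0 ≤ ψ x)
    (hK0 : 0 ≤ K) (hK : ∀ i x, |D i ψ x| ≤ K)
    {A : Set E2} (hA : MeasurableSet A) (hsub : tsupport ψ ⊆ A)
    (hAi : IntegrableOn (fun x => Real.exp (v x)) A)
    (hmass : ∫ x in A, Real.exp (v x) ≤ m)
    (hsmall : 16 * b * S * m ≤ 1)
    (heq : ∀ x, ψ x ≠ 0 → -lap v x ≤ b * Real.exp (v x)) :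
    ∫ x, Real.exp (v x) * (D 0 v x ^ 2 + D 1 v x ^ 2) * ψ x ^ 2 ≤
      4 * (8 * b * S * K ^ 2 * m ^ 2 + 4 * K ^ 2 * m) := by
  have vd := hv.differentiable (by norm_num)
  have vc := hv.continuous
  have ψd := hψ.differentiable (by norm_num)
  have ψc := hψ.continuous
  have lc := lap_cont hv
  have p0 := (D_contDiff hv 0).continuous
  have p1 := (D_contDiff hv 1).continuous
  have f0 := D_cont hψ 0
  have f1 := D_cont hψ 1
  have hz : ∀ x, x ∉ tsupport ψ → ψ x = 0 ∧ D 0 ψ x = 0 ∧ D 1 ψ x = 0 := fun x hx =>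
    ⟨image_eq_zero_of_notMem_tsupport hx, D_supp hx 0, D_supp hx 1⟩
  have key : ∀ g : E2 → ℝ, Continuous g → (∀ x, ψ x = 0 → D 0 ψ x = 0 → D 1 ψ x = 0 → g x = 0) →
      Integrable g := by
    intro g hg h
    apply hg.integrable_of_hasCompactSupport
    apply HasCompactSupport.intro (K := tsupport ψ) hc
    intro x hx
    obtain ⟨a1, a2, a3⟩ := hz x hx
    exact h x a1 a2 a3
  have bnd : ∀ (g : E2 → ℝ) (c : ℝ), 0 ≤ c → Continuous g →
      (∀ x, ψ x = 0 → D 0 ψ x = 0 → D 1 ψ x = 0 → g x = 0) →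
      (∀ x, g x ≤ c * Real.exp (v x)) → ∫ x, g x ≤ c * m := by
    intro g c hc0 hg h hle
    have : ∫ x, g x = ∫ x in A, g x := by
      rw [setIntegral_eq_integral_of_forall_compl_eq_zero]
      intro x hx
      obtain ⟨a1, a2, a3⟩ := hz x (fun h => hx (hsub h))
      exact h x a1 a2 a3
    rw [this]
    calc ∫ x in A, g x ≤ ∫ x in A, c * Real.exp (v x) :=
          integral_mono (key g hg h).integrableOn (hAi.const_mul c) hle
      _ = c * ∫ x in A, Real.exp (v x) := integral_const_mul _ _
      _ ≤ c * m := by gcongr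
  set E := ∫ x, Real.exp (v x) * (D 0 v x ^ 2 + D 1 v x ^ 2) * ψ x ^ 2 with hE
  have iE : Integrable fun x => Real.exp (v x) * (D 0 v x ^ 2 + D 1 v x ^ 2) * ψ x ^ 2 :=
    key _ (by fun_prop) (by intro x h _ _; simp [h])
  -- Sobolev
  have ecd : ContDiff ℝ 1 fun x => Real.exp (v x) := Real.contDiff_exp.comp (hv.of_le (by norm_num))
  have eD : ∀ i x, D i (fun x => Real.exp (v x)) x = Real.exp (v x) * D i v x := by
    intro i x
    rw [D_comp (g := Real.exp) (vd x) (Real.hasDerivAt_exp _)]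
  have s1 := hSob (fun x => Real.exp (v x) * ψ x) (ecd.mul hψ) hc.mul_left
  have eW : ∀ i x, D i (fun x => Real.exp (v x) * ψ x) x
      = Real.exp (v x) * D i v x * ψ x + Real.exp (v x) * D i ψ x := by
    intro i x
    rw [D_mul (ecd.differentiable (by norm_num) x) (ψd x), eD]
  simp_rw [eW] at s1
  set I1 := ∫ x, Real.exp (v x) * (|D 0 v x| + |D 1 v x|) * ψ x with hI1
  have iI1 : Integrable fun x => Real.exp (v x) * (|D 0 v x| + |D 1 v x|) * ψ x :=
    key _ (by fun_prop) (by intro x h _ _; simp [h])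
  set I2 := ∫ x, Real.exp (v x) * (|D 0 ψ x| + |D 1 ψ x|) with hI2
  have iI2 : Integrable fun x => Real.exp (v x) * (|D 0 ψ x| + |D 1 ψ x|) :=
    key _ (by fun_prop) (by intro x h h' h''; simp [h', h''])
  have hI1n : 0 ≤ I1 := integral_nonneg fun x => by have := h0 x; positivity
  have hI2n : 0 ≤ I2 := integral_nonneg fun x => by positivity
  have hI : ∫ x, (|Real.exp (v x) * D 0 v x * ψ x + Real.exp (v x) * D 0 ψ x| +
      |Real.exp (v x) * D 1 v x * ψ x + Real.exp (v x) * D 1 ψ x|) ≤ I1 + I2 := by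
    rw [hI1, hI2, ← integral_add iI1 iI2]
    apply integral_mono
    · exact key _ (by fun_prop) (by intro x h h' h''; simp [h, h', h''])
    · exact iI1.add iI2
    · intro x
      have e : ∀ p q : ℝ, |Real.exp (v x) * p * ψ x + Real.exp (v x) * q| ≤
          Real.exp (v x) * |p| * ψ x + Real.exp (v x) * |q| := by
        intro p q
        refine (abs_add_le _ _).trans ?_
        rw [abs_mul, abs_mul, abs_mul, abs_of_pos (Real.exp_pos _), abs_of_nonneg (h0 x)]
      have := e (D 0 v x) (D 0 ψ x)
      have := e (D 1 v x) (D 1 ψ x)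
      simp only
      linarith
  have hI2b : I2 ≤ 2 * K * m := by
    apply bnd _ (2 * K) (by positivity) (by fun_prop) (by intro x h h' h''; simp [h', h''])
    intro x
    have := hK 0 x
    have := hK 1 x
    have := Real.exp_pos (v x)
    nlinarith
  have hI1b : I1 ^ 2 ≤ m * (2 * E) := by
    apply cs_real hm hI1n
    intro l hl
    -- 2 I1 ≤ l m + 2E/l
    have t1 : ∫ x, (2 * (Real.exp (v x) * (|D 0 v x| + |D 1 v x|) * ψ x) -
        (2 / l) * (Real.exp (v x) * (D 0 v x ^ 2 + D 1 v x ^ 2) * ψ x ^ 2)) ≤ l * m := by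
      apply bnd _ l hl.le (by fun_prop) (by intro x h h' h''; simp [h])
      intro x
      have hex := Real.exp_pos (v x)
      have h1 : ∀ p : ℝ, 2 * (|p| * ψ x) ≤ l / 2 + (2 / l) * (p ^ 2 * ψ x ^ 2) := by
        intro p
        have := sq_nonneg (l - 2 * (|p| * ψ x))
        have e : l / 2 + (2 / l) * (p ^ 2 * ψ x ^ 2) = (l ^ 2 + 4 * (|p| * ψ x) ^ 2) / (2 * l) := by
          rw [mul_pow, sq_abs]; field_simp; ring
        rw [e, le_div_iff₀ (by positivity)]
        nlinarith
      have := h1 (D 0 v x)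
      have := h1 (D 1 v x)
      have : 2 * ((|D 0 v x| + |D 1 v x|) * ψ x) -
        (2 / l) * ((D 0 v x ^ 2 + D 1 v x ^ 2) * ψ x ^ 2) ≤ l := by nlinarith
      have := mul_le_mul_of_nonneg_left this hex.le
      linarith
    rw [integral_sub (iI1.const_mul 2) (iE.const_mul _), integral_const_mul, integral_const_mul,
      ← hE, ← hI1] at t1
    have : 2 * E / l = 2 / l * E := by ring
    rw [this]; linarith
  have s2 : ∫ x, (Real.exp (v x) * ψ x) ^ 2 ≤ S * (4 * m * E + 8 * K ^ 2 * m ^ 2) := by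
    refine s1.trans ?_
    gcongr
    calc _ ≤ (I1 + I2) ^ 2 := by
          gcongr
      _ ≤ 2 * I1 ^ 2 + 2 * I2 ^ 2 := by nlinarith [sq_nonneg (I1 - I2)]
      _ ≤ 2 * (m * (2 * E)) + 2 * (2 * K * m) ^ 2 := by gcongr
      _ = _ := by ring
  -- energy
  have w1 := weak hv (G := fun x => Real.exp (v x) * ψ x ^ 2) (ecd.mul (hψ.pow 2))
    ((hc.comp_left (g := fun t => t ^ 2) (by norm_num)).mul_left)
  have e1 : ∀ i x, D i (fun x => Real.exp (v x) * ψ x ^ 2) x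
      = Real.exp (v x) * D i v x * ψ x ^ 2 + Real.exp (v x) * (2 * ψ x * D i ψ x) := by
    intro i x
    rw [D_mul (ecd.differentiable (by norm_num) x) (by have := ψd x; fun_prop), eD,
      D_comp (g := fun t => t ^ 2) (ψd x) (hasDerivAt_pow 2 _)]
    simp
  simp_rw [e1] at w1
  have iG : Integrable fun x => Real.exp (v x) * (D 0 ψ x ^ 2 + D 1 ψ x ^ 2) :=
    key _ (by fun_prop) (by intro x h h' h''; simp [h', h''])
  have hG : ∫ x, Real.exp (v x) * (D 0 ψ x ^ 2 + D 1 ψ x ^ 2) ≤ (2 * K ^ 2) * m := by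
    apply bnd _ _ (by positivity) (by fun_prop) (by intro x h h' h''; simp [h', h''])
    intro x
    have := sq_le_sq' (abs_le.1 (hK 0 x)).1 (abs_le.1 (hK 0 x)).2
    have := sq_le_sq' (abs_le.1 (hK 1 x)).1 (abs_le.1 (hK 1 x)).2
    have := Real.exp_pos (v x)
    nlinarith
  have s3 : (1/2) * E - 2 * ∫ x, Real.exp (v x) * (D 0 ψ x ^ 2 + D 1 ψ x ^ 2) ≤
      ∫ x, -lap v x * (Real.exp (v x) * ψ x ^ 2) := by
    rw [w1, hE, ← integral_const_mul, ← integral_const_mul,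
      ← integral_sub (iE.const_mul _) (iG.const_mul _)]
    apply integral_mono
    · exact (iE.const_mul _).sub (iG.const_mul _)
    · exact key _ (by fun_prop) (by intro x h h' h''; simp [h])
    · intro x
      simp only
      have hex := Real.exp_pos (v x)
      have h1 : ∀ p q : ℝ, (1/2) * (p ^ 2 * ψ x ^ 2) - 2 * q ^ 2 ≤
          p * (p * ψ x ^ 2 + 2 * ψ x * q) := by
        intro p q
        nlinarith [sq_nonneg (p * ψ x + 2 * q)]
      have a0 := mul_le_mul_of_nonneg_left (h1 (D 0 v x) (D 0 ψ x)) hex.le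
      have a1 := mul_le_mul_of_nonneg_left (h1 (D 1 v x) (D 1 ψ x)) hex.le
      linarith
  have s4 : ∫ x, -lap v x * (Real.exp (v x) * ψ x ^ 2) ≤ b * ∫ x, (Real.exp (v x) * ψ x) ^ 2 := by
    rw [← integral_const_mul]
    apply integral_mono
    · exact key _ (by fun_prop) (by intro x h h' h''; simp [h])
    · exact key _ (by fun_prop) (by intro x h h' h''; simp [h])
    · intro x
      simp only
      by_cases h : ψ x = 0
      · simp [h]
      have hex := Real.exp_pos (v x)
      have := mul_le_mul_of_nonneg_right (heq x h) (show 0 ≤ Real.exp (v x) * ψ x ^ 2 by positivity)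
      linarith
  have hEn : 0 ≤ E := integral_nonneg fun x => by positivity
  have s5 := mul_le_mul_of_nonneg_left s2 hb.le
  have s6 := mul_le_mul_of_nonneg_right hsmall hEn
  nlinarith


/-- The stress tensor of `v` at `x`, evaluated on two vectors given by coordinates. -/
def TT (v : E2 → ℝ) (x : E2) (a0 a1 b0 b1 : ℝ) : ℝ :=
  (1/2) * (D 0 v x ^ 2 - D 1 v x ^ 2) * (a0 * b0 - a1 * b1) + D 0 v x * D 1 v x * (a0 * b1 + a1 * b0)

lemma coord_cd (j : Fin 2) : ContDiff ℝ 1 (fun x : E2 => x j) :=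
  (EuclideanSpace.proj j : E2 →L[ℝ] ℝ).contDiff

lemma D_coord_sub (i j : Fin 2) (x0 x : E2) :
    D i (fun y => y j - x0 j) x = if i = j then 1 else 0 := by
  rw [D_sub ((coord_cd j).differentiable (by norm_num) x) (differentiableAt_const _), D_coord,
    D_const, sub_zero]

lemma poho1 {v η : E2 → ℝ} (x0 : E2) (hv : ContDiff ℝ 2 v) (hη : ContDiff ℝ 1 η)
    (hc : HasCompactSupport η) :
    ∫ x, (-lap v x) * (η x * ((x 0 - x0 0) * D 0 v x + (x 1 - x0 1) * D 1 v x)) =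
      ∫ x, TT v x (D 0 η x) (D 1 η x) (x 0 - x0 0) (x 1 - x0 1) := by
  have c0 := D_contDiff hv 0
  have c1 := D_contDiff hv 1
  have y0 : ContDiff ℝ 1 (fun x : E2 => x 0 - x0 0) := (coord_cd 0).sub contDiff_const
  have y1 : ContDiff ℝ 1 (fun x : E2 => x 1 - x0 1) := (coord_cd 1).sub contDiff_const
  have d0 := c0.differentiable (by norm_num)
  have d1 := c1.differentiable (by norm_num)
  have dy0 := y0.differentiable (by norm_num)
  have dy1 := y1.differentiable (by norm_num)
  have dη := hη.differentiable (by norm_num)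
  have k0 := c0.continuous
  have k1 := c1.continuous
  have ky0 := y0.continuous
  have ky1 := y1.continuous
  have kη := hη.continuous
  have f0 := D_cont hη 0
  have f1 := D_cont hη 1
  have lc := lap_cont hv
  set A0 : E2 → ℝ := fun x => (1/2) * (D 0 v x * D 0 v x - D 1 v x * D 1 v x) * (x 0 - x0 0)
    + D 0 v x * D 1 v x * (x 1 - x0 1) with hA0
  set A1 : E2 → ℝ := fun x => D 0 v x * D 1 v x * (x 0 - x0 0)
    - (1/2) * (D 0 v x * D 0 v x - D 1 v x * D 1 v x) * (x 1 - x0 1) with hA1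
  have a0 : ContDiff ℝ 1 A0 := by
    rw [hA0]; fun_prop
  have a1 : ContDiff ℝ 1 A1 := by
    rw [hA1]; fun_prop
  have h := int_div_zero (F := fun x => A0 x * η x) (G := fun x => A1 x * η x)
    (a0.mul hη) hc.mul_left (a1.mul hη) hc.mul_left
  have e : ∀ x, D 0 (fun x => A0 x * η x) x + D 1 (fun x => A1 x * η x) x
      = TT v x (D 0 η x) (D 1 η x) (x 0 - x0 0) (x 1 - x0 1) -
        (-lap v x) * (η x * ((x 0 - x0 0) * D 0 v x + (x 1 - x0 1) * D 1 v x)) := by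
    intro x
    rw [D_mul (a0.differentiable (by norm_num) x) (dη x),
      D_mul (a1.differentiable (by norm_num) x) (dη x), lap_eq hv.contDiffAt]
    have q0 : D 0 A0 x = (1/2) * (2 * D 0 v x * D 0 (D 0 v) x - 2 * D 1 v x * D 0 (D 1 v) x)
        * (x 0 - x0 0) + (1/2) * (D 0 v x * D 0 v x - D 1 v x * D 1 v x)
        + (D 0 (D 0 v) x * D 1 v x + D 0 v x * D 0 (D 1 v) x) * (x 1 - x0 1) := by
      rw [hA0, D_add (by fun_prop) (by fun_prop), D_mul (by fun_prop) (by fun_prop),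
        D_mul (by fun_prop) (by fun_prop), D_mul (by fun_prop) (by fun_prop),
        D_mul (by fun_prop) (by fun_prop), D_sub (by fun_prop) (by fun_prop),
        D_mul (by fun_prop) (by fun_prop), D_mul (by fun_prop) (by fun_prop),
        D_coord_sub, D_coord_sub, D_const]
      rw [if_pos rfl, if_neg (by decide)]; ring
    have q1 : D 1 A1 x = (D 1 (D 0 v) x * D 1 v x + D 0 v x * D 1 (D 1 v) x) * (x 0 - x0 0)
        - (1/2) * (2 * D 0 v x * D 1 (D 0 v) x - 2 * D 1 v x * D 1 (D 1 v) x)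
        * (x 1 - x0 1) - (1/2) * (D 0 v x * D 0 v x - D 1 v x * D 1 v x) := by
      rw [hA1, D_sub (by fun_prop) (by fun_prop), D_mul (by fun_prop) (by fun_prop),
        D_mul (by fun_prop) (by fun_prop), D_mul (by fun_prop) (by fun_prop),
        D_mul (by fun_prop) (by fun_prop), D_coord_sub, D_coord_sub,
        D_sub (by fun_prop) (by fun_prop),
        D_mul (by fun_prop) (by fun_prop), D_mul (by fun_prop) (by fun_prop), D_const]
      rw [if_neg (by decide), if_pos rfl]; ring
    rw [q0, q1, D_symm hv.contDiffAt 1 0, hA0, hA1]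
    unfold TT
    ring
  simp_rw [e] at h
  rw [integral_sub] at h
  · linarith
  · apply Continuous.integrable_of_hasCompactSupport
    · unfold TT; fun_prop
    · apply HasCompactSupport.intro (K := tsupport η) hc
      intro x hx
      simp [TT, D_supp hx]
  · apply Continuous.integrable_of_hasCompactSupport
    · fun_prop
    · apply HasCompactSupport.intro (K := tsupport η) hc
      intro x hx
      simp [image_eq_zero_of_notMem_tsupport hx]

lemma poho2 {v R V : E2 → ℝ} {L : NNReal} (x0 : E2) (hV : LipschitzWith L V)
    (hv : ContDiff ℝ 1 v) (hR : ContDiff ℝ 1 R)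
    (hc : HasCompactSupport R) (hR0 : ∀ x, 0 ≤ R x) :
    ∫ x, V x * (Real.exp (v x) * (R x * ((x 0 - x0 0) * D 0 v x + (x 1 - x0 1) * D 1 v x)
      + 2 * R x + ((x 0 - x0 0) * D 0 R x + (x 1 - x0 1) * D 1 R x))) ≤
    ∫ x, L * ‖x - x0‖ * (R x * Real.exp (v x)) := by
  have y : ∀ i, ContDiff ℝ 1 (fun x : E2 => x i - x0 i) := fun i => (coord_cd i).sub contDiff_const
  have dy := fun i => (y i).differentiable (by norm_num)
  have ky := fun i => (y i).continuous
  have dv := hv.differentiable (by norm_num)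
  have dR := hR.differentiable (by norm_num)
  have kR := hR.continuous
  have kv := hv.continuous
  have kD := D_cont hv
  have kDR := D_cont hR
  have kV := hV.continuous
  have ecd : ContDiff ℝ 1 fun x => Real.exp (v x) := Real.contDiff_exp.comp hv
  have ed := ecd.differentiable (by norm_num)
  have eD : ∀ i x, D i (fun x => Real.exp (v x)) x = Real.exp (v x) * D i v x := by
    intro i x
    rw [D_comp (g := Real.exp) (dv x) (Real.hasDerivAt_exp _)]
  set g : Fin 2 → E2 → ℝ := fun i x => (R x * (x i - x0 i)) * Real.exp (v x) with hg
  have gcd : ∀ i, ContDiff ℝ 1 (g i) := fun i => (hR.mul (y i)).mul ecd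
  have gcs : ∀ i, HasCompactSupport (g i) := fun i => (hc.mul_right).mul_right
  have Dg : ∀ i x, D i (g i) x = (D i R x * (x i - x0 i) + R x) * Real.exp (v x)
      + R x * (x i - x0 i) * (Real.exp (v x) * D i v x) := by
    intro i x
    rw [hg]
    simp only
    rw [D_mul ((hR.mul (y i)).differentiable (by norm_num) x) (ed x), D_mul (dR x) (dy i x), eD,
      D_coord_sub]
    simp
  have ibp : ∀ i, ∫ x, lineDeriv ℝ V x (ee i) * g i x = - ∫ x, V x * D i (g i) x := by
    intro i
    obtain ⟨C, hC⟩ := ContDiff.lipschitzWith_of_hasCompactSupport (gcs i) (gcd i) (by norm_num)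
    rw [hV.integral_lineDeriv_mul_eq hC (gcs i), ← integral_neg]
    congr 1; funext x
    rw [((gcd i).differentiable (by norm_num) x).lineDeriv_eq_fderiv]
    simp [D]; ring
  have key : ∀ h : E2 → ℝ, Continuous h → (∀ x, R x = 0 → D 0 R x = 0 → D 1 R x = 0 → h x = 0) →
      Integrable h := by
    intro h hh hz
    apply hh.integrable_of_hasCompactSupport
    apply HasCompactSupport.intro (K := tsupport R) hc
    intro x hx
    exact hz x (image_eq_zero_of_notMem_tsupport hx) (D_supp hx 0) (D_supp hx 1)
  have i0 : ∀ i, Integrable fun x => V x * D i (g i) x := by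
    intro i
    have := D_cont (gcd i) i
    exact Continuous.integrable_of_hasCompactSupport (by fun_prop) (hcs_D (gcs i) i).mul_left
  have iL : ∀ i, Integrable fun x => lineDeriv ℝ V x (ee i) * g i x := by
    intro i
    have hb : Integrable (g i) := (gcd i).continuous.integrable_of_hasCompactSupport (gcs i)
    apply hb.bdd_mul (c := L * ‖ee i‖)
    · exact (measurable_lineDeriv kV).aestronglyMeasurable
    · exact Filter.Eventually.of_forall fun x => norm_lineDeriv_le_of_lipschitz ℝ hV
  have main : ∫ x, V x * (Real.exp (v x) * (R x * ((x 0 - x0 0) * D 0 v x + (x 1 - x0 1) * D 1 v x)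
      + 2 * R x + ((x 0 - x0 0) * D 0 R x + (x 1 - x0 1) * D 1 R x))) =
      ∫ x, -(lineDeriv ℝ V x (ee 0) * g 0 x + lineDeriv ℝ V x (ee 1) * g 1 x) := by
    rw [integral_neg, integral_add (iL 0) (iL 1), ibp, ibp, ← neg_add, neg_neg,
      ← integral_add (i0 0) (i0 1)]
    congr 1; funext x
    rw [Dg, Dg]; ring
  rw [main]
  apply integral_mono_ae
  · exact ((iL 0).add (iL 1)).neg
  · exact key _ (by fun_prop) (by intro x h _ _; simp [h])
  · filter_upwards [hV.ae_differentiableAt (μ := (volume : Measure E2))] with x hx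
    have hy : x - x0 = (x 0 - x0 0) • ee 0 + (x 1 - x0 1) • ee 1 := by
      ext i; fin_cases i <;> simp [ee]
    have e : lineDeriv ℝ V x (ee 0) * g 0 x + lineDeriv ℝ V x (ee 1) * g 1 x
        = fderiv ℝ V x (x - x0) * (R x * Real.exp (v x)) := by
      rw [hx.lineDeriv_eq_fderiv, hx.lineDeriv_eq_fderiv, hg]
      conv_rhs => rw [hy]
      simp; ring
    rw [e]
    have h1 : ‖fderiv ℝ V x (x - x0)‖ ≤ L * ‖x - x0‖ :=
      ((fderiv ℝ V x).le_opNorm _).trans (by gcongr; exact norm_fderiv_le_of_lipschitz ℝ hV)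
    rw [Real.norm_eq_abs] at h1
    have h2 := (abs_le.1 h1).1
    have h3 : 0 ≤ R x * Real.exp (v x) := mul_nonneg (hR0 x) (Real.exp_pos _).le
    nlinarith


lemma normsq_E2 (x : E2) : ‖x‖ ^ 2 = x 0 ^ 2 + x 1 ^ 2 := by
  rw [EuclideanSpace.norm_sq_eq, Fin.sum_univ_two]; simp

/-- the weight -/
def rho (β : ℝ) (x0 x : E2) : ℝ := ‖x - x0‖ ^ (2 * β)

lemma rho_nonneg (β : ℝ) (x0 x : E2) : 0 ≤ rho β x0 x := rpow_nonneg (norm_nonneg _) _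

lemma rho_cont {β : ℝ} (hβ : 0 < β) (x0 : E2) : Continuous (rho β x0) := by
  unfold rho
  exact Continuous.rpow_const (by fun_prop) (fun x => Or.inr (by positivity))

lemma rho_cd {β : ℝ} {x0 x : E2} (h : x ≠ x0) : ContDiffAt ℝ 1 (rho β x0) x := by
  unfold rho
  apply ContDiffAt.rpow_const_of_ne
  · exact ContDiffAt.norm ℝ (by fun_prop) (sub_ne_zero.2 h)
  · exact norm_ne_zero_iff.2 (sub_ne_zero.2 h)

lemma rho_eq (β : ℝ) (x0 x : E2) :
    rho β x0 x = ((x 0 - x0 0) * (x 0 - x0 0) + (x 1 - x0 1) * (x 1 - x0 1)) ^ β := by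
  unfold rho
  rw [rpow_mul (norm_nonneg _)]
  congr 1
  rw [rpow_two, normsq_E2]
  simp; ring

lemma rho_euler {β : ℝ} {x0 x : E2} (h : x ≠ x0) :
    (x 0 - x0 0) * D 0 (rho β x0) x + (x 1 - x0 1) * D 1 (rho β x0) x = 2 * β * rho β x0 x := by
  have y : ∀ i, ContDiff ℝ 1 (fun x : E2 => x i - x0 i) := fun i => (coord_cd i).sub contDiff_const
  have dy := fun i => (y i).differentiable (by norm_num)
  set f : E2 → ℝ := fun x => (x 0 - x0 0) * (x 0 - x0 0) + (x 1 - x0 1) * (x 1 - x0 1) with hf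
  have hpos : 0 < f x := by
    have h1 : 0 < ‖x - x0‖ ^ 2 := by
      have := norm_pos_iff.2 (sub_ne_zero.2 h); positivity
    rw [normsq_E2] at h1
    simp only [hf]; simp at h1; nlinarith
  have e : rho β x0 = fun x => f x ^ β := by funext x; exact rho_eq β x0 x
  have df : DifferentiableAt ℝ f x := by
    rw [hf]
    exact ((dy 0 x).mul (dy 0 x)).add ((dy 1 x).mul (dy 1 x))
  have d : ∀ i, D i (rho β x0) x = (β * f x ^ (β - 1)) * D i f x := by
    intro i
    rw [e, D_comp (g := fun t => t ^ β) df (Real.hasDerivAt_rpow_const (Or.inl hpos.ne'))]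
  have d0 : ∀ i, D i f x = 2 * (x i - x0 i) := by
    intro i
    rw [hf, D_add ((dy 0 x).fun_mul (dy 0 x)) ((dy 1 x).fun_mul (dy 1 x)), D_mul (dy 0 x) (dy 0 x),
      D_mul (dy 1 x) (dy 1 x), D_coord_sub, D_coord_sub]
    fin_cases i <;> simp <;> ring
  have e2 : f x ^ β = f x ^ (β - 1) * f x := by
    rw [rpow_sub_one hpos.ne']; field_simp
  rw [d, d, d0, d0]
  have e3 : rho β x0 x = f x ^ (β - 1) * f x := by rw [← e2, e]
  rw [e3, hf]; ring

lemma poho {v η V : E2 → ℝ} {L : NNReal} {a β : ℝ} (x0 : E2) (hβ : 0 < β)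
    (hV : LipschitzWith L V) (hv : ContDiff ℝ 2 v) (hη : ContDiff ℝ 1 η)
    (hc : HasCompactSupport η) (h0 : ∀ x, 0 ≤ η x) (hx0 : x0 ∉ tsupport η)
    (heq : ∀ x, η x ≠ 0 → -lap v x = (1 + rho β x0 x) * V x * Real.exp (v x))
    (hVa : ∀ x, η x ≠ 0 → a ≤ V x) (hL : ∀ x, η x ≠ 0 → L * ‖x - x0‖ ≤ a / 2) (ha : 0 < a) :
    (1/2) * ∫ x, V x * Real.exp (v x) * (2 + 2 * (β + 1) * rho β x0 x) * η x ≤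
      (- ∫ x, TT v x (D 0 η x) (D 1 η x) (x 0 - x0 0) (x 1 - x0 1))
      - ∫ x, V x * Real.exp (v x) * (1 + rho β x0 x) *
          ((x 0 - x0 0) * D 0 η x + (x 1 - x0 1) * D 1 η x) := by
  set R : E2 → ℝ := fun x => (1 + rho β x0 x) * η x with hR
  have dη := hη.differentiable (by norm_num)
  have kV := hV.continuous
  have kv := hv.continuous
  have kη := hη.continuous
  have kD := D_cont (hv.of_le (by norm_num : (1:WithTop ℕ∞) ≤ 2))
  have kDη := D_cont hη
  have kr := rho_cont hβ x0
  have ky : ∀ i, Continuous (fun x : E2 => x i - x0 i) :=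
    fun i => (coord_cd i).continuous.sub continuous_const
  have Rz : ∀ x, x ∉ tsupport η → R =ᶠ[nhds x] fun _ => 0 := by
    intro x hx
    have := notMem_tsupport_iff_eventuallyEq.1 hx
    filter_upwards [this] with z hz
    simp [hR, hz]
  have Rcd : ContDiff ℝ 1 R := by
    rw [contDiff_iff_contDiffAt]
    intro x
    by_cases hx : x ∈ tsupport η
    · have hne : x ≠ x0 := fun h => hx0 (h ▸ hx)
      exact (contDiffAt_const.add (rho_cd hne)).mul hη.contDiffAt
    · exact contDiffAt_const.congr_of_eventuallyEq (Rz x hx)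
  have Rc : HasCompactSupport R := hc.mul_left
  have R0 : ∀ x, 0 ≤ R x := fun x => mul_nonneg (by have := rho_nonneg β x0 x; linarith) (h0 x)
  have Re : ∀ x, 2 * R x + ((x 0 - x0 0) * D 0 R x + (x 1 - x0 1) * D 1 R x)
      = (2 + 2 * (β + 1) * rho β x0 x) * η x +
        (1 + rho β x0 x) * ((x 0 - x0 0) * D 0 η x + (x 1 - x0 1) * D 1 η x) := by
    intro x
    by_cases hx : x ∈ tsupport η
    · have hne : x ≠ x0 := fun h => hx0 (h ▸ hx)
      have dr : DifferentiableAt ℝ (rho β x0) x := (rho_cd hne).differentiableAt (by norm_num)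
      have d : ∀ i, D i R x = D i (rho β x0) x * η x + (1 + rho β x0 x) * D i η x := by
        intro i
        rw [hR, D_mul ((differentiableAt_const _).fun_add dr) (dη x),
          D_add (differentiableAt_const _) dr, D_const, zero_add]
      have := rho_euler (β := β) hne
      rw [d, d, hR]
      linear_combination η x * this
    · rw [D_congr (Rz x hx), D_congr (Rz x hx), D_const, D_const, D_supp hx, D_supp hx]
      simp [hR, image_eq_zero_of_notMem_tsupport hx]
  have p2 := poho2 x0 hV (hv.of_le (by norm_num)) Rcd Rc R0
  have p1 := poho1 x0 hv hη hc
  have key : ∀ h : E2 → ℝ, Continuous h → (∀ x, η x = 0 → D 0 η x = 0 → D 1 η x = 0 → h x = 0) →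
      Integrable h := by
    intro h hh hz
    apply hh.integrable_of_hasCompactSupport
    apply HasCompactSupport.intro (K := tsupport η) hc
    intro x hx
    exact hz x (image_eq_zero_of_notMem_tsupport hx) (D_supp hx 0) (D_supp hx 1)
  have lc := lap_cont hv
  have e : ∀ x, V x * (Real.exp (v x) * (R x * ((x 0 - x0 0) * D 0 v x + (x 1 - x0 1) * D 1 v x)
      + 2 * R x + ((x 0 - x0 0) * D 0 R x + (x 1 - x0 1) * D 1 R x))) =
      (-lap v x) * (η x * ((x 0 - x0 0) * D 0 v x + (x 1 - x0 1) * D 1 v x)) +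
      (V x * Real.exp (v x) * (2 + 2 * (β + 1) * rho β x0 x) * η x +
       V x * Real.exp (v x) * (1 + rho β x0 x) *
          ((x 0 - x0 0) * D 0 η x + (x 1 - x0 1) * D 1 η x)) := by
    intro x
    have h1 : (-lap v x) * η x = V x * Real.exp (v x) * R x := by
      by_cases hx : η x = 0
      · simp [hR, hx]
      · rw [heq x hx, hR]; ring
    have h2 := Re x
    linear_combination (V x * Real.exp (v x)) * h2 -
      ((x 0 - x0 0) * D 0 v x + (x 1 - x0 1) * D 1 v x) * h1
  simp_rw [e] at p2
  have I1 : Integrable fun x => V x * Real.exp (v x) * (2 + 2 * (β + 1) * rho β x0 x) * η x :=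
    key _ (by fun_prop) (by intro x h _ _; simp [h])
  have I2 : Integrable fun x => V x * Real.exp (v x) * (1 + rho β x0 x) *
          ((x 0 - x0 0) * D 0 η x + (x 1 - x0 1) * D 1 η x) :=
    key _ (by fun_prop) (by intro x h h1 h2; simp [h1, h2])
  have I3 : Integrable fun x => (-lap v x) *
      (η x * ((x 0 - x0 0) * D 0 v x + (x 1 - x0 1) * D 1 v x)) :=
    key _ (by fun_prop) (by intro x h h1 h2; simp [h])
  have I4 : Integrable fun x => L * ‖x - x0‖ * (R x * Real.exp (v x)) :=
    key _ (by fun_prop) (by intro x h h1 h2; simp [hR, h])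
  have I12 := I1.add I2
  rw [integral_add I3 (by exact I12), integral_add I1 I2, p1] at p2
  have p3 : ∫ x, L * ‖x - x0‖ * (R x * Real.exp (v x)) ≤
      ∫ x, (1/2) * (V x * Real.exp (v x) * (2 + 2 * (β + 1) * rho β x0 x) * η x) := by
    apply integral_mono I4 (I1.const_mul _)
    intro x
    by_cases hx : η x = 0
    · simp [hR, hx]
    · have h1 := hL x hx
      have h2 := hVa x hx
      have h3 := rho_nonneg β x0 x
      have h4 := h0 x
      simp only [hR]
      have h5 : L * ‖x - x0‖ * (1 + rho β x0 x) ≤ V x * (1 + (β + 1) * rho β x0 x) := by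
        calc L * ‖x - x0‖ * (1 + rho β x0 x) ≤ V x * (1 + rho β x0 x) := by
              gcongr; linarith
          _ ≤ _ := by
              have : 0 ≤ V x := by linarith
              gcongr
              nlinarith
      have h6 : 0 ≤ η x * Real.exp (v x) := mul_nonneg h4 (Real.exp_pos _).le
      have := mul_le_mul_of_nonneg_right h5 h6
      linarith
  rw [integral_const_mul] at p3
  linarith


lemma nsq_cd (n : WithTop ℕ∞) : ContDiff ℝ n (fun x : E2 => ‖x‖ ^ 2) := contDiff_norm_sq ℝ

lemma rad_cd {h : ℝ → ℝ} {n : WithTop ℕ∞} (hh : ContDiff ℝ n h) :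
    ContDiff ℝ n (fun x : E2 => h (‖x‖ ^ 2)) := hh.comp (nsq_cd n)

lemma D_nsq (i : Fin 2) (x : E2) : D i (fun y => ‖y‖ ^ 2) x = 2 * x i := by
  have e : (fun y : E2 => ‖y‖ ^ 2) = fun y => y 0 * y 0 + y 1 * y 1 := by
    funext y; rw [normsq_E2]; ring
  have dy := fun j => (coord_cd j).differentiable (by norm_num)
  rw [e, D_add ((dy 0 x).fun_mul (dy 0 x)) ((dy 1 x).fun_mul (dy 1 x)), D_mul (dy 0 x) (dy 0 x),
      D_mul (dy 1 x) (dy 1 x), D_coord, D_coord]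
  fin_cases i <;> simp <;> ring

lemma D_rad {h : ℝ → ℝ} {h' : ℝ} (x : E2) (hh : HasDerivAt h h' (‖x‖ ^ 2)) (i : Fin 2) :
    D i (fun y => h (‖y‖ ^ 2)) x = h' * (2 * x i) := by
  rw [D_comp (f := fun y : E2 => ‖y‖ ^ 2) ((nsq_cd 1).differentiable (by norm_num) x) hh, D_nsq]

lemma rad_tsupp {h : ℝ → ℝ} {p q : ℝ} (hz : ∀ s, s < p ∨ q < s → h s = 0) :
    tsupport (fun x : E2 => h (‖x‖ ^ 2)) ⊆ {x | p ≤ ‖x‖ ^ 2 ∧ ‖x‖ ^ 2 ≤ q} := by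
  apply closure_minimal
  · intro x hx
    by_contra hc
    apply hx
    apply hz
    simp only [Set.mem_ofPred_eq, not_and_or, not_le] at hc
    exact hc
  · exact isClosed_Icc.preimage (nsq_cd 1).continuous

lemma rad_hcs {h : ℝ → ℝ} {p q : ℝ} (hz : ∀ s, s < p ∨ q < s → h s = 0) :
    HasCompactSupport (fun x : E2 => h (‖x‖ ^ 2)) := by
  apply HasCompactSupport.of_support_subset_isCompact (isCompact_closedBall (0:E2) (|q| + 1))
  intro x hx
  have h1 := rad_tsupp hz (subset_tsupport _ hx)
  simp only [Set.mem_ofPred_eq] at h1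
  simp only [Metric.mem_closedBall, dist_zero_right]
  have := le_abs_self q
  have := abs_nonneg q
  nlinarith [norm_nonneg x]

/-- smooth one-dimensional bump: zero outside `(p,q)`, one on `[p+w, q-r]`. -/
def bmp (p w q r s : ℝ) : ℝ := smoothTransition ((s - p) / w) * smoothTransition ((q - s) / r)

lemma bmp_cd (p w q r : ℝ) (n : ℕ∞) : ContDiff ℝ n (bmp p w q r) := by
  unfold bmp
  apply ContDiff.mul
  · exact smoothTransition.contDiff.comp (by fun_prop)
  · exact smoothTransition.contDiff.comp (by fun_prop)

lemma bmp_nonneg (p w q r s : ℝ) : 0 ≤ bmp p w q r s :=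
  mul_nonneg (smoothTransition.nonneg _) (smoothTransition.nonneg _)

lemma bmp_le_one (p w q r s : ℝ) : bmp p w q r s ≤ 1 :=
  mul_le_one₀ (smoothTransition.le_one _) (smoothTransition.nonneg _) (smoothTransition.le_one _)

lemma bmp_zero {p w q r s : ℝ} (hw : 0 < w) (hr : 0 < r) (h : s ≤ p ∨ q ≤ s) :
    bmp p w q r s = 0 := by
  unfold bmp
  rcases h with h | h
  · rw [smoothTransition.zero_of_nonpos (div_nonpos_of_nonpos_of_nonneg (by linarith) hw.le), zero_mul]
  · rw [smoothTransition.zero_of_nonpos (x := (q - s)/r)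
      (div_nonpos_of_nonpos_of_nonneg (by linarith) hr.le), mul_zero]

lemma bmp_one {p w q r s : ℝ} (hw : 0 < w) (hr : 0 < r) (h : p + w ≤ s) (h' : s ≤ q - r) :
    bmp p w q r s = 1 := by
  unfold bmp
  rw [smoothTransition.one_of_one_le ((one_le_div hw).2 (by linarith)),
    smoothTransition.one_of_one_le ((one_le_div hr).2 (by linarith)), mul_one]

lemma D_bdd {f : E2 → ℝ} (hf : ContDiff ℝ 1 f) (hc : HasCompactSupport f) :
    ∃ K, 0 ≤ K ∧ ∀ i x, |D i f x| ≤ K := by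
  obtain ⟨K0, h0⟩ := (D_cont hf 0).bounded_above_of_compact_support (hcs_D hc 0)
  obtain ⟨K1, h1⟩ := (D_cont hf 1).bounded_above_of_compact_support (hcs_D hc 1)
  refine ⟨max K0 K1, ((norm_nonneg _).trans (h0 0)).trans (le_max_left _ _), ?_⟩
  intro i x
  fin_cases i
  · exact (h0 x).trans (le_max_left _ _)
  · exact (h1 x).trans (le_max_right _ _)

/-- shells -/
def shell (p q : ℝ) : Set E2 := {x | p ≤ ‖x‖ ^ 2 ∧ ‖x‖ ^ 2 < q}

lemma shell_meas (p q : ℝ) : MeasurableSet (shell p q) :=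
  (nsq_cd 1).continuous.measurable measurableSet_Ico

lemma shell_int {f : E2 → ℝ} (hf : Continuous f) (p q : ℝ) : IntegrableOn f (shell p q) := by
  apply (hf.continuousOn.integrableOn_compact (isCompact_closedBall (0:E2) (|q| + 1))).mono_set
  intro x hx
  simp only [Metric.mem_closedBall, dist_zero_right]
  have := le_abs_self q
  have := abs_nonneg q
  have := hx.2
  nlinarith [norm_nonneg x]

lemma core_le {v ψ : E2 → ℝ} {p q : ℝ} (hv : ContDiff ℝ 2 v) (hv0 : ∀ x, 0 ≤ v x)
    (hψ : ContDiff ℝ 1 ψ) (hc : HasCompactSupport ψ) (h1 : ∀ x ∈ shell p q, ψ x = 1) :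
    ∫ x in shell p q, (D 0 v x ^ 2 + D 1 v x ^ 2) ≤
      ∫ x, Real.exp (v x) * (D 0 v x ^ 2 + D 1 v x ^ 2) * ψ x ^ 2 := by
  have kD := D_cont (hv.of_le (by norm_num : (1:WithTop ℕ∞) ≤ 2))
  have k0 := kD 0
  have k1 := kD 1
  have kv := hv.continuous
  have kψ := hψ.continuous
  have c1 : Continuous fun x => D 0 v x ^ 2 + D 1 v x ^ 2 := by fun_prop
  have c2 : Continuous fun x => Real.exp (v x) * (D 0 v x ^ 2 + D 1 v x ^ 2) * ψ x ^ 2 := by fun_prop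
  have ii : Integrable fun x => Real.exp (v x) * (D 0 v x ^ 2 + D 1 v x ^ 2) * ψ x ^ 2 := by
    apply Continuous.integrable_of_hasCompactSupport c2
    apply HasCompactSupport.intro (K := tsupport ψ) hc
    intro x hx
    simp [image_eq_zero_of_notMem_tsupport hx]
  refine le_trans (setIntegral_mono_on (shell_int c1 p q) ii.integrableOn (shell_meas p q) ?_)
    (setIntegral_le_integral ii (Filter.Eventually.of_forall fun x => ?_))
  · intro x hx
    rw [h1 x hx]
    have h3 : 1 ≤ Real.exp (v x) := Real.one_le_exp (hv0 x)
    have h4 : 0 ≤ D 0 v x ^ 2 + D 1 v x ^ 2 := by positivity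
    nlinarith
  · have := Real.exp_pos (v x)
    show 0 ≤ Real.exp (v x) * (D 0 v x ^ 2 + D 1 v x ^ 2) * ψ x ^ 2
    positivity

lemma bmp_core {p w : ℝ} (hw : 0 < w) {x : E2} (hx : x ∈ shell (p + w) (p + 2 * w)) :
    bmp (p + w/2) (w/2) (p + 5 * w/2) (w/2) (‖x‖ ^ 2) = 1 := by
  obtain ⟨h1, h2⟩ := hx
  apply bmp_one (by linarith) (by linarith) <;> linarith

/-- the interior estimate -/
lemma interior_est {a b : ℝ} (ha : 0 < a) (hb : 0 < b) : ∃ (w M E : ℝ) (N : ℕ), 0 < w ∧ 0 ≤ M ∧ 0 ≤ E ∧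
    ∀ v : E2 → ℝ, ContDiff ℝ 2 v → (∀ x, 0 ≤ v x) →
    (∀ x, 5/16 ≤ ‖x‖ ^ 2 → ‖x‖ ^ 2 ≤ 7/8 →
      a * Real.exp (v x) ≤ -lap v x ∧ -lap v x ≤ b * Real.exp (v x)) →
    ∃ p, 9/16 ≤ p ∧ p + 3 * w ≤ 5/8 ∧
      ∫ x in shell (p + w) (p + 2 * w), Real.exp (v x) ≤ M ∧
      ∫ x in shell (p + w) (p + 2 * w), (D 0 v x ^ 2 + D 1 v x ^ 2) ≤ E := by
  obtain ⟨S, hS, hSob⟩ := sobolev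
  set φ : E2 → ℝ := fun x => bmp (5/16) (1/4) (7/8) (1/4) (‖x‖ ^ 2) with hφ
  have φcd : ContDiff ℝ 1 φ := rad_cd (by simpa using bmp_cd (5/16) (1/4) (7/8) (1/4) 1)
  have φc : HasCompactSupport φ := rad_hcs (p := 5/16) (q := 7/8) (by
    intro s hs
    exact bmp_zero (by norm_num) (by norm_num) (by rcases hs with h | h <;> [left; right] <;> linarith))
  obtain ⟨K0, hK0, hK⟩ := D_bdd φcd φc
  set P := ∫ x, (D 0 φ x ^ 2 + D 1 φ x ^ 2) with hP
  have P0 : 0 ≤ P := integral_nonneg fun x => by positivity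
  set M := (4 * P + 72 * (2 * K0 ^ 2) / a * (2 * P)) / a + 1 with hM
  have M1 : 0 < M := by positivity
  have M0 : 0 ≤ M := M1.le
  obtain ⟨N, hN⟩ := exists_nat_gt (16 * b * S * M)
  have Npos : (0:ℝ) < N := lt_of_le_of_lt (by positivity) hN
  set w : ℝ := 1 / (48 * N) with hw
  have wpos : 0 < w := by positivity
  have hwN : 3 * w * N = 1/16 := by rw [hw]; field_simp; norm_num
  set m := M / N with hm
  have m0 : 0 < m := by positivity
  have hsmall : 16 * b * S * m ≤ 1 := by
    rw [hm, mul_div_assoc', div_le_one Npos]; exact hN.le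
  set s : ℕ → ℝ := fun k => 9/16 + 3 * k * w with hs
  set ψ : ℕ → E2 → ℝ := fun k x => bmp (s k + w/2) (w/2) (s k + 5 * w/2) (w/2) (‖x‖ ^ 2) with hψ
  have ψcd : ∀ k, ContDiff ℝ 1 (ψ k) := fun k => rad_cd (by
    simpa using bmp_cd (s k + w/2) (w/2) (s k + 5 * w/2) (w/2) 1)
  have ψz : ∀ k t, t < s k + w/2 ∨ s k + 5 * w/2 < t →
      bmp (s k + w/2) (w/2) (s k + 5 * w/2) (w/2) t = 0 := fun k t ht =>
    bmp_zero (by linarith) (by linarith) (by rcases ht with h | h <;> [left; right] <;> linarith)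
  have ψc : ∀ k, HasCompactSupport (ψ k) := fun k => rad_hcs (ψz k)
  have hKK : ∀ k, ∃ K, 0 ≤ K ∧ ∀ i x, |D i (ψ k) x| ≤ K := fun k => D_bdd (ψcd k) (ψc k)
  choose K K0' hKb using hKK
  set Ek : ℕ → ℝ := fun k => 4 * (8 * b * S * K k ^ 2 * m ^ 2 + 4 * K k ^ 2 * m) with hEk
  have Ek0 : ∀ k, 0 ≤ Ek k := fun k => by simp only [hEk]; positivity
  refine ⟨w, M, ∑ k ∈ Finset.range N, Ek k, N, wpos, M0, Finset.sum_nonneg fun k _ => Ek0 k, ?_⟩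
  intro v hv hv0 heq
  have ec : Continuous fun x => Real.exp (v x) := Real.continuous_exp.comp hv.continuous
  have kD := D_cont (hv.of_le (by norm_num : (1:WithTop ℕ∞) ≤ 2))
  have φne : ∀ x, φ x ≠ 0 → 5/16 ≤ ‖x‖ ^ 2 ∧ ‖x‖ ^ 2 ≤ 7/8 := by
    intro x hx
    by_contra hc
    apply hx
    apply bmp_zero (by norm_num) (by norm_num)
    by_contra h; push Not at h
    exact hc ⟨h.1.le, h.2.le⟩
  have mb := mass_bound (v := v) (φ := φ) (K := 2 * K0 ^ 2) (P := P) ha hv hv0 φcd φc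
    (fun x => bmp_nonneg _ _ _ _ _) (fun x => bmp_le_one _ _ _ _ _) (by positivity)
    (fun x => by
      have h0 := sq_le_sq' (by have := abs_le.1 (hK 0 x); linarith) (abs_le.1 (hK 0 x)).2
      have h1 := sq_le_sq' (by have := abs_le.1 (hK 1 x); linarith) (abs_le.1 (hK 1 x)).2
      linarith) le_rfl (fun x hx => (heq x (φne x hx).1 (φne x hx).2).1)
  have φi : Integrable fun x => φ x ^ 4 * Real.exp (v x) := by
    have := φcd.continuous
    apply Continuous.integrable_of_hasCompactSupport (by fun_prop)
    apply HasCompactSupport.intro (K := tsupport φ) φc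
    intro x hx
    simp [image_eq_zero_of_notMem_tsupport hx]
  have mb2 : ∫ x, φ x ^ 4 * Real.exp (v x) ≤ M := by
    have : ∫ x, φ x ^ 4 * Real.exp (v x) ≤ (4 * P + 72 * (2 * K0 ^ 2) / a * (2 * P)) / a := by
      rw [le_div_iff₀ ha, mul_comm]; exact mb
    linarith
  have dis : Set.PairwiseDisjoint (↑(Finset.range N) : Set ℕ) fun k => shell (s k) (s k + 3 * w) := by
    intro i _ j _ hij
    rw [Function.onFun, Set.disjoint_left]
    intro x hx hy
    simp only [shell, Set.mem_ofPred_eq, hs] at hx hy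
    rcases lt_or_gt_of_ne hij with h | h
    · have : (i:ℝ) + 1 ≤ j := by exact_mod_cast h
      nlinarith [hx.2, hy.1]
    · have : (j:ℝ) + 1 ≤ i := by exact_mod_cast h
      nlinarith [hx.1, hy.2]
  have hsum : ∑ k ∈ Finset.range N, ∫ x in shell (s k) (s k + 3 * w), Real.exp (v x) ≤ M := by
    rw [← integral_biUnion_finset _ (fun k _ => shell_meas _ _) dis (fun k _ => shell_int ec _ _)]
    refine le_trans ?_ mb2
    have mU : MeasurableSet (⋃ k ∈ Finset.range N, shell (s k) (s k + 3 * w)) :=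
      Finset.measurableSet_biUnion _ fun k _ => shell_meas _ _
    refine le_trans (le_of_eq ?_) (setIntegral_le_integral (s := ⋃ k ∈ Finset.range N, shell (s k) (s k + 3 * w)) φi
      (Filter.Eventually.of_forall fun x => by
        have := Real.exp_pos (v x); have := bmp_nonneg (5/16) (1/4) (7/8) (1/4) (‖x‖ ^ 2)
        simp only [hφ]; positivity))
    apply setIntegral_congr_fun mU
    intro x hx
    simp only [Set.mem_iUnion, Finset.mem_range] at hx
    obtain ⟨k, hk, h1, h2⟩ := hx
    have hk' : (k:ℝ) + 1 ≤ N := by exact_mod_cast hk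
    have : φ x = 1 := by
      apply bmp_one (by norm_num) (by norm_num)
      · simp only [hs] at h1
        have : (0:ℝ) ≤ k := by positivity
        nlinarith
      · simp only [hs] at h2
        nlinarith
    simp [this]
  have hex : ∃ k ∈ Finset.range N, ∫ x in shell (s k) (s k + 3 * w), Real.exp (v x) ≤ m := by
    by_contra hc
    push Not at hc
    have : ∑ k ∈ Finset.range N, m < ∑ k ∈ Finset.range N, ∫ x in shell (s k) (s k + 3 * w), Real.exp (v x) := by
      apply Finset.sum_lt_sum_of_nonempty _ hc
      rw [Finset.nonempty_range_iff]
      rintro rfl; simp at Npos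
    rw [Finset.sum_const, Finset.card_range, nsmul_eq_mul, hm, mul_div_cancel₀ _ Npos.ne'] at this
    linarith
  obtain ⟨k, hk, hmk⟩ := hex
  have hk' : (k:ℝ) + 1 ≤ N := by exact_mod_cast Finset.mem_range.1 hk
  have kk : (0:ℝ) ≤ k := by positivity
  have s1 : 9/16 ≤ s k := by simp only [hs]; nlinarith
  have s2 : s k + 3 * w ≤ 5/8 := by simp only [hs]; nlinarith
  have sub : shell (s k + w) (s k + 2 * w) ⊆ shell (s k) (s k + 3 * w) := by
    intro x hx; exact ⟨by linarith [hx.1], by linarith [hx.2]⟩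
  have ψne : ∀ x, ψ k x ≠ 0 → s k + w / 2 ≤ ‖x‖ ^ 2 ∧ ‖x‖ ^ 2 ≤ s k + 5 * w/2 := by
    intro x hx
    exact rad_tsupp (ψz k) (subset_tsupport _ hx)
  have er := eps_reg hS hSob (v := v) (ψ := ψ k) (b := b) (K := K k) (m := m) hb m0 hv (ψcd k)
    (ψc k) (fun x => bmp_nonneg _ _ _ _ _) (K0' k) (hKb k)
    (shell_meas (s k) (s k + 3 * w)) (fun x hx => by
      have := rad_tsupp (ψz k) hx
      exact ⟨by linarith [this.1], by linarith [this.2]⟩) (shell_int ec _ _) hmk hsmall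
    (fun x hx => (heq x (by linarith [(ψne x hx).1]) (by linarith [(ψne x hx).2])).2)
  refine ⟨s k, s1, s2, ?_, ?_⟩
  · calc ∫ x in shell (s k + w) (s k + 2 * w), Real.exp (v x)
        ≤ ∫ x in shell (s k) (s k + 3 * w), Real.exp (v x) :=
          setIntegral_mono_set (shell_int ec _ _) (Filter.Eventually.of_forall fun x => (Real.exp_pos _).le)
            (Filter.Eventually.of_forall sub)
      _ ≤ m := hmk
      _ ≤ M := by
        rw [hm]; apply div_le_self M0
        linarith
  · have q1 : ∀ x ∈ shell (s k + w) (s k + 2 * w), ψ k x = 1 := by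
      intro x hx
      exact bmp_core wpos hx
    have q2 := core_le hv hv0 (ψcd k) (ψc k) q1
    have q3 : Ek k ≤ ∑ k ∈ Finset.range N, Ek k :=
      Finset.single_le_sum (f := Ek) (fun k _ => Ek0 k) hk
    have q4 : Ek k = 4 * (8 * b * S * K k ^ 2 * m ^ 2 + 4 * K k ^ 2 * m) := rfl
    rw [← q4] at er
    exact q2.trans (er.trans q3)


lemma polar_E2 (f : E2 → ℝ) :
    ∫ x, f x = ∫ p in Set.Ioi (0:ℝ) ×ˢ Set.Ioo (-π) π, p.1 * f (circlePt p.1 p.2) := by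
  have h1 := (PiLp.volume_preserving_toLp (Fin 2)).integral_comp
    (MeasurableEquiv.toLp 2 (Fin 2 → ℝ)).measurableEmbedding f
  have h2 := (volume_preserving_finTwoArrow ℝ).symm.integral_comp
    (MeasurableEquiv.finTwoArrow (α := ℝ)).symm.measurableEmbedding
    (fun y => f (WithLp.toLp 2 y))
  rw [← h1, ← h2, ← integral_comp_polarCoord_symm]
  rfl

lemma norm_circlePt {r : ℝ} (hr : 0 ≤ r) (θ : ℝ) : ‖circlePt r θ‖ = r := by
  have : ‖circlePt r θ‖ ^ 2 = r ^ 2 := by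
    rw [normsq_E2]
    simp [circlePt]
    nlinarith [Real.sin_sq_add_cos_sq θ]
  exact (pow_left_inj₀ (norm_nonneg _) hr (by norm_num)).1 this

lemma circlePt_smul (c r θ : ℝ) : c • circlePt r θ = circlePt (c * r) θ := by
  ext i; fin_cases i <;> simp [circlePt, mul_assoc]

/-- inner cutoff profile -/
def AA (ε s : ℝ) : ℝ := smoothTransition ((s - 1/4 - ε) / ε)
def AA' (ε s : ℝ) : ℝ := deriv smoothTransition ((s - 1/4 - ε) / ε) / ε

lemma st_cd (n : ℕ∞) : ContDiff ℝ n smoothTransition := smoothTransition.contDiff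

lemma AA_deriv (ε s : ℝ) : HasDerivAt (AA ε) (AA' ε s) s := by
  have h1 : HasDerivAt smoothTransition (deriv smoothTransition ((s - 1/4 - ε) / ε))
      ((s - 1/4 - ε) / ε) :=
    (((st_cd 1).differentiable (by norm_num)) _).hasDerivAt
  have h2 : HasDerivAt (fun s : ℝ => (s - 1/4 - ε) / ε) (1 / ε) s :=
    ((((hasDerivAt_id s).sub_const (1/4)).sub_const ε).div_const ε)
  have := h1.comp s h2
  rw [AA', div_eq_mul_one_div]
  exact this

lemma st'_nonneg (t : ℝ) : 0 ≤ deriv smoothTransition t := by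
  have : Monotone smoothTransition := smoothTransition.monotone
  exact this.deriv_nonneg

lemma st'_zero {t : ℝ} (h : t < 0 ∨ 1 < t) : deriv smoothTransition t = 0 := by
  rcases h with h | h
  · have : smoothTransition =ᶠ[nhds t] fun _ => 0 := by
      filter_upwards [Iio_mem_nhds h] with s hs using smoothTransition.zero_of_nonpos (le_of_lt hs)
    rw [this.deriv_eq, deriv_const]
  · have : smoothTransition =ᶠ[nhds t] fun _ => 1 := by
      filter_upwards [Ioi_mem_nhds h] with s hs using smoothTransition.one_of_one_le (le_of_lt hs)
    rw [this.deriv_eq, deriv_const]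

lemma st'_cont : Continuous (deriv smoothTransition) :=
  (st_cd 1).continuous_deriv (by norm_num)

lemma st'_bdd : ∃ G, 0 < G ∧ ∀ t, deriv smoothTransition t ≤ G := by
  have hc : HasCompactSupport (deriv smoothTransition) :=
    HasCompactSupport.intro (K := Set.Icc 0 1) isCompact_Icc (fun t ht => st'_zero (by
      simp only [Set.mem_Icc, not_and_or, not_le] at ht; exact ht))
  obtain ⟨G, hG⟩ := st'_cont.bounded_above_of_compact_support hc
  refine ⟨|G| + 1, by positivity, fun t => ?_⟩
  have := (le_abs_self _).trans (hG t)
  linarith [le_abs_self G]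

lemma AA'_nonneg {ε : ℝ} (hε : 0 < ε) (s : ℝ) : 0 ≤ AA' ε s := div_nonneg (st'_nonneg _) hε.le

lemma AA'_zero {ε s : ℝ} (hε : 0 < ε) (h : s < 1/4 + ε ∨ 1/4 + 2 * ε < s) : AA' ε s = 0 := by
  unfold AA'
  rw [st'_zero, zero_div]
  rcases h with h | h
  · left; exact div_neg_of_neg_of_pos (by linarith) hε
  · right; rw [one_lt_div hε]; linarith

lemma AA'_cont (ε : ℝ) : Continuous (AA' ε) := by
  unfold AA'
  exact (st'_cont.comp (by fun_prop)).div_const _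

lemma AA_one {ε s : ℝ} (hε : 0 < ε) (h : 1/4 + 2 * ε ≤ s) : AA ε s = 1 :=
  smoothTransition.one_of_one_le (by rw [one_le_div hε]; linarith)

lemma AA_zero {ε s : ℝ} (hε : 0 < ε) (h : s ≤ 1/4 + ε) : AA ε s = 0 :=
  smoothTransition.zero_of_nonpos (div_nonpos_of_nonpos_of_nonneg (by linarith) hε.le)

lemma rad_int {ε : ℝ} (hε : 0 < ε) : ∫ r in Set.Ioi (0:ℝ), r * (2 * AA' ε (r ^ 2)) = 1 := by
  have h := integral_Ioi_of_hasDerivAt_of_nonneg' (g := fun r => AA ε (r ^ 2))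
    (g' := fun r => r * (2 * AA' ε (r ^ 2))) (a := 0) (l := 1) (fun r _ => ?_) (fun r hr => ?_) ?_
  · rw [h]
    simp only [ne_eq, OfNat.ofNat_ne_zero, not_false_eq_true, zero_pow]
    rw [AA_zero hε (by linarith)]; norm_num
  · have := (AA_deriv ε (r ^ 2)).comp r (hasDerivAt_pow 2 r)
    have e : r * (2 * AA' ε (r ^ 2)) = AA' ε (r ^ 2) * (((2:ℕ):ℝ) * r ^ (2 - 1)) := by
      push_cast; ring
    rw [e]; exact this
  · have := AA'_nonneg hε (r ^ 2)
    have : 0 < r := hr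
    positivity
  · apply tendsto_const_nhds.congr'
    filter_upwards [Filter.eventually_ge_atTop (1 + 2 * ε)] with r hr
    rw [AA_one hε]; nlinarith

lemma polar_int {ε : ℝ} (hε : 0 < ε) (m : E2 → ℝ) :
    ∫ x : E2, 2 * AA' ε (‖x‖ ^ 2) * m ((1 / (2 * ‖x‖)) • x) =
      ∫ θ in (0:ℝ)..(2 * π), m (circlePt (1/2) θ) := by
  rw [polar_E2]
  have e : ∫ p in Set.Ioi (0:ℝ) ×ˢ Set.Ioo (-π) π, p.1 * (2 * AA' ε (‖circlePt p.1 p.2‖ ^ 2) *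
      m ((1 / (2 * ‖circlePt p.1 p.2‖)) • circlePt p.1 p.2)) =
      ∫ p in Set.Ioi (0:ℝ) ×ˢ Set.Ioo (-π) π, (p.1 * (2 * AA' ε (p.1 ^ 2))) *
        m (circlePt (1/2) p.2) := by
    apply setIntegral_congr_fun (measurableSet_Ioi.prod measurableSet_Ioo)
    rintro ⟨r, θ⟩ ⟨hr, _⟩
    have hr' : 0 < r := hr
    simp only
    rw [norm_circlePt hr'.le, circlePt_smul]
    have : 1 / (2 * r) * r = 1/2 := by field_simp
    rw [this]; ring
  rw [e]
  have := setIntegral_prod_mul (μ := (volume : Measure ℝ)) (ν := (volume : Measure ℝ))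
    (fun r => r * (2 * AA' ε (r ^ 2))) (fun θ => m (circlePt (1/2) θ)) (Set.Ioi 0) (Set.Ioo (-π) π)
  rw [← Measure.volume_eq_prod] at this
  rw [this, rad_int hε, one_mul, ← integral_Ioc_eq_integral_Ioo,
    ← intervalIntegral.integral_of_le (by linarith [pi_pos])]
  have per : Function.Periodic (fun θ => m (circlePt (1/2) θ)) (2 * π) := by
    intro θ; simp [circlePt]
  have h2 := per.intervalIntegral_add_eq (-π) 0
  rw [zero_add] at h2
  rw [← h2]; congr 1; ring


lemma Omega_open : IsOpen Omega :=
  isOpen_Ioo.preimage (f := fun x : E2 => ‖x‖) continuous_norm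

lemma closure_Omega : closure Omega = {x : E2 | 1/2 ≤ ‖x‖ ∧ ‖x‖ ≤ 1} := by
  apply Set.Subset.antisymm
  · apply closure_minimal
    · intro x hx; exact ⟨hx.1.le, hx.2.le⟩
    · exact isClosed_Icc.preimage (f := fun x : E2 => ‖x‖) continuous_norm
  · rintro x ⟨h1, h2⟩
    have hx : 0 < ‖x‖ := by linarith
    have ht : Filter.Tendsto (fun t : ℝ => (1 - t + t * (3 / (4 * ‖x‖))) • x)
        (nhdsWithin 0 (Set.Ioi 0)) (nhds x) := by
      have : Continuous (fun t : ℝ => (1 - t + t * (3 / (4 * ‖x‖))) • x) := by fun_prop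
      have h := (this.tendsto 0).mono_left (nhdsWithin_le_nhds (s := Set.Ioi 0))
      simpa using h
    apply mem_closure_of_tendsto ht
    filter_upwards [Ioo_mem_nhdsGT (show (0:ℝ) < 1 by norm_num)] with t ht
    have hp : 0 < 1 - t + t * (3 / (4 * ‖x‖)) := by
      have := ht.1; have := ht.2
      have : 0 < 1 - t := by linarith
      positivity
    have hn : ‖(1 - t + t * (3 / (4 * ‖x‖))) • x‖ = (1 - t) * ‖x‖ + t * (3/4) := by
      rw [norm_smul, Real.norm_of_nonneg hp.le]; field_simp
    show 1/2 < ‖_‖ ∧ ‖_‖ < 1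
    rw [hn]
    constructor <;> nlinarith [ht.1, ht.2]

lemma closure_compact : IsCompact (closure Omega) := by
  apply (isCompact_closedBall (0:E2) 1).of_isClosed_subset isClosed_closure
  rw [closure_Omega]
  intro x hx; simpa using hx.2

lemma Omega_ud : UniqueDiffOn ℝ (closure Omega) := by
  intro y hy
  rw [closure_Omega] at hy ⊢
  obtain ⟨h1, h2⟩ := hy
  have hpos : 0 < ‖y‖ := by linarith
  set K : Set E2 := {x | ‖x‖ ≤ 1} ∩ {x | ‖y‖ / 2 ≤ ⟪y, x⟫} with hK
  have hconv : Convex ℝ K := by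
    apply Convex.inter
    · have := convex_closedBall (0:E2) 1
      have e : {x : E2 | ‖x‖ ≤ 1} = Metric.closedBall 0 1 := by
        ext x; simp
      rw [e]; exact this
    · exact convex_halfSpace_ge (𝕜 := ℝ) (f := fun x => ⟪y, x⟫)
        ⟨fun a b => inner_add_right _ _ _, fun c a => by simp [inner_smul_right]⟩ _
  have hint : (interior K).Nonempty := by
    refine ⟨(3 / (4 * ‖y‖)) • y, ?_⟩
    have ho : IsOpen ({x : E2 | ‖x‖ < 1} ∩ {x | ‖y‖ / 2 < ⟪y, x⟫}) :=
      (isOpen_Iio.preimage (f := fun x : E2 => ‖x‖) continuous_norm).inter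
        (isOpen_Ioi.preimage (f := fun x : E2 => ⟪y, x⟫) (by fun_prop))
    apply interior_maximal (s := K) _ ho
    · constructor
      · show ‖_‖ < 1
        rw [norm_smul, Real.norm_of_nonneg (by positivity)]
        have : 3 / (4 * ‖y‖) * ‖y‖ = 3/4 := by field_simp
        rw [this]; norm_num
      · show ‖y‖ / 2 < ⟪y, _⟫
        rw [inner_smul_right, real_inner_self_eq_norm_sq]
        have : 3 / (4 * ‖y‖) * ‖y‖ ^ 2 = 3/4 * ‖y‖ := by field_simp
        rw [this]; linarith
    · rintro x ⟨h3, h4⟩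
      have h3' : ‖x‖ < 1 := h3
      have h4' : ‖y‖ / 2 < ⟪y, x⟫ := h4
      exact ⟨show ‖x‖ ≤ 1 from h3'.le, show ‖y‖ / 2 ≤ ⟪y, x⟫ from h4'.le⟩
  have hyK : y ∈ K := by
    refine ⟨h2, ?_⟩
    show ‖y‖ / 2 ≤ ⟪y, y⟫
    rw [real_inner_self_eq_norm_sq]; nlinarith
  refine (uniqueDiffWithinAt_convex hconv hint (subset_closure hyK)).mono ?_
  rintro x ⟨h3, h4⟩
  refine ⟨?_, h3⟩
  have h5 : ‖y‖ / 2 ≤ ‖y‖ * ‖x‖ := le_trans h4 (real_inner_le_norm y x)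
  by_contra hc; push Not at hc
  nlinarith

lemma mem_frontier_of {x : E2} (hx : x ∈ closure Omega) (hn : x ∉ Omega) : x ∈ frontier Omega := by
  rw [frontier, Omega_open.interior_eq]; exact ⟨hx, hn⟩

lemma sol_cda {u : E2 → ℝ} (hu : ContDiffOn ℝ 2 u (closure Omega)) {x : E2} (hx : x ∈ Omega) :
    ContDiffAt ℝ 2 u x :=
  (hu x (subset_closure hx)).contDiffAt (Filter.mem_of_superset (Omega_open.mem_nhds hx) subset_closure)

lemma D_D_min {u : E2 → ℝ} {x : E2} (hu : ContDiffAt ℝ 2 u x) (hm : IsLocalMin u x) (i : Fin 2) :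
    0 ≤ D i (D i u) x := by
  by_contra hneg
  push Not at hneg
  set l : ℝ → E2 := fun t => x + t • ee i with hl
  have l0 : l 0 = x := by simp [hl]
  have lc : Continuous l := by rw [hl]; fun_prop
  have ld : ∀ t, HasDerivAt l (ee i) t := by
    intro t
    have := ((hasDerivAt_id t).smul_const (ee i)).const_add x
    rw [one_smul] at this
    exact this
  have ev : ∀ᶠ t in nhds (0:ℝ), ContDiffAt ℝ 2 u (l t) := by
    have h := hu.eventually (by simp)
    have : Filter.Tendsto l (nhds 0) (nhds x) := by
      have := lc.tendsto 0; rwa [l0] at this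
    exact this.eventually h
  have d1 : ∀ t, ContDiffAt ℝ 2 u (l t) → HasDerivAt (fun t => u (l t)) (D i u (l t)) t := by
    intro t ht
    exact (ht.differentiableAt (by norm_num)).hasFDerivAt.comp_hasDerivAt t (ld t)
  have e1 : deriv (fun t => u (l t)) =ᶠ[nhds 0] fun t => D i u (l t) := by
    filter_upwards [ev] with t ht using (d1 t ht).deriv
  have d2 : HasDerivAt (fun t => D i u (l t)) (D i (D i u) x) 0 := by
    have h1 : DifferentiableAt ℝ (D i u) x := by
      have h1 : ContDiffAt ℝ 1 (fderiv ℝ u) x := hu.fderiv_right (by norm_num)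
      exact (h1.differentiableAt (by norm_num)).clm_apply (differentiableAt_const _)
    have h2 := h1.hasFDerivAt
    rw [← l0] at h2
    have h3 := h2.comp_hasDerivAt 0 (ld 0)
    rw [l0] at h3
    exact h3
  have e2 : deriv (deriv (fun t => u (l t))) 0 = D i (D i u) x := by
    rw [e1.deriv_eq, d2.deriv]
  have lm : IsLocalMin (fun t => u (l t)) 0 := by
    have : Filter.Tendsto l (nhds 0) (nhds x) := by
      have := lc.tendsto 0; rwa [l0] at this
    have h := this.eventually hm
    filter_upwards [h] with t ht
    rw [l0]; exact ht
  have lM : IsLocalMax (fun t => u (l t)) 0 := by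
    apply isLocalMax_of_deriv_deriv_neg
    · rw [e2]; exact hneg
    · exact lm.deriv_eq_zero
    · exact (d1 0 (by rw [l0]; exact hu)).continuousAt
  have ec : (fun t => u (l t)) =ᶠ[nhds 0] fun _ => u (l 0) := by
    filter_upwards [lm, lM] with t h1 h2
    exact le_antisymm h2 h1
  have : deriv (deriv (fun t => u (l t))) 0 = 0 := by
    rw [ec.deriv.deriv_eq]; simp
  rw [e2] at this
  linarith

lemma sol_nonneg {u : E2 → ℝ} (hu : ContDiffOn ℝ 2 u (closure Omega))
    (hb : ∀ x ∈ frontier Omega, u x = 0) (hl : ∀ x ∈ Omega, 0 < -lap u x) :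
    ∀ x ∈ closure Omega, 0 ≤ u x := by
  intro x hx
  obtain ⟨z, hz, hzm⟩ := closure_compact.exists_isMinOn ⟨x, hx⟩ hu.continuousOn
  have h1 : u z ≤ u x := hzm hx
  refine le_trans ?_ h1
  by_cases hzO : z ∈ Omega
  · exfalso
    have hcd := sol_cda hu hzO
    have hm : IsLocalMin u z :=
      hzm.isLocalMin (Filter.mem_of_superset (Omega_open.mem_nhds hzO) subset_closure)
    have := hl z hzO
    rw [lap_eq hcd] at this
    have := D_D_min hcd hm 0
    have := D_D_min hcd hm 1
    linarith
  · rw [hb z (mem_frontier_of hz hzO)]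


/-- radial derivative from within the closed annulus -/
def nn (u : E2 → ℝ) (y : E2) : ℝ := fderivWithin ℝ u (closure Omega) y y

/-- partial derivatives from within the closed annulus -/
def DW (i : Fin 2) (u : E2 → ℝ) (y : E2) : ℝ := fderivWithin ℝ u (closure Omega) y (ee i)

lemma E2_decomp (y : E2) : y = y 0 • ee 0 + y 1 • ee 1 := by
  ext i; fin_cases i <;> simp [ee]

lemma nn_eq (u : E2 → ℝ) (y : E2) : nn u y = y 0 * DW 0 u y + y 1 * DW 1 u y := by
  unfold nn DW
  conv_lhs => rw [E2_decomp y]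
  rw [map_add, map_smul, map_smul, ← E2_decomp y]
  simp

lemma DW_cont {u : E2 → ℝ} (hu : ContDiffOn ℝ 2 u (closure Omega)) (i : Fin 2) :
    ContinuousOn (DW i u) (closure Omega) := by
  have := hu.continuousOn_fderivWithin Omega_ud (by norm_num)
  exact this.clm_apply continuousOn_const

lemma DW_eq {u : E2 → ℝ} {x : E2} (hx : x ∈ Omega) (i : Fin 2) : DW i u x = D i u x := by
  unfold DW D
  rw [fderivWithin_of_mem_nhds (Filter.mem_of_superset (Omega_open.mem_nhds hx) subset_closure)]

lemma inner_mem {y : E2} (hy : ‖y‖ = 1/2) : y ∈ closure Omega := by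
  rw [closure_Omega]; exact ⟨by rw [hy], by rw [hy]; norm_num⟩

lemma inner_bd {u : E2 → ℝ} (hb : ∀ x ∈ frontier Omega, u x = 0) {y : E2} (hy : ‖y‖ = 1/2) :
    u y = 0 := by
  apply hb _ (mem_frontier_of (inner_mem hy) _)
  intro h
  have := h.1
  rw [hy] at this; exact lt_irrefl _ this

lemma hasFD {u : E2 → ℝ} (hu : ContDiffOn ℝ 2 u (closure Omega)) {y : E2} (hy : y ∈ closure Omega) :
    HasFDerivWithinAt u (fderivWithin ℝ u (closure Omega) y) (closure Omega) y :=
  (hu.differentiableOn (by norm_num) y hy).hasFDerivWithinAt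

lemma nn_nonneg {u : E2 → ℝ} (hu : ContDiffOn ℝ 2 u (closure Omega))
    (hb : ∀ x ∈ frontier Omega, u x = 0) (h0 : ∀ x ∈ closure Omega, 0 ≤ u x)
    {y : E2} (hy : ‖y‖ = 1/2) : 0 ≤ nn u y := by
  have hm : IsLocalMinOn u (closure Omega) y := by
    filter_upwards [self_mem_nhdsWithin] with x hx
    rw [inner_bd hb hy]; exact h0 x hx
  apply hm.hasFDerivWithinAt_nonneg (hasFD hu (inner_mem hy))
  apply mem_posTangentConeAt_of_segment_subset
  rw [segment_eq_image', closure_Omega]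
  rintro x ⟨t, ht, rfl⟩
  have e : y + t • (y + y - y) = (1 + t) • y := by module
  show 1/2 ≤ ‖y + t • (y + y - y)‖ ∧ ‖y + t • (y + y - y)‖ ≤ 1
  rw [e]
  have : ‖(1 + t) • y‖ = (1 + t) * (1/2) := by
    rw [norm_smul, hy, Real.norm_of_nonneg (by linarith [ht.1])]
  rw [this]
  constructor <;> linarith [ht.1, ht.2]

lemma tang_zero {u : E2 → ℝ} (hu : ContDiffOn ℝ 2 u (closure Omega))
    (hb : ∀ x ∈ frontier Omega, u x = 0) {y : E2} (hy : ‖y‖ = 1/2) :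
    y 0 * DW 1 u y - y 1 * DW 0 u y = 0 := by
  set J : E2 := (-y 1) • ee 0 + (y 0) • ee 1 with hJ
  have J0 : J 0 = - y 1 := by simp [hJ, ee]
  have J1 : J 1 = y 0 := by simp [hJ, ee]
  set γ : ℝ → E2 := fun t => Real.cos t • y + Real.sin t • J with hγ
  have hn : ∀ t, ‖γ t‖ = 1/2 := by
    intro t
    have h1 : ‖γ t‖ ^ 2 = (1/2) ^ 2 := by
      have h2 := normsq_E2 y
      rw [hy] at h2
      rw [normsq_E2, h2]
      simp only [hγ, PiLp.add_apply, PiLp.smul_apply, smul_eq_mul, J0, J1]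
      nlinarith [Real.sin_sq_add_cos_sq t]
    exact (pow_left_inj₀ (norm_nonneg _) (by norm_num) (by norm_num)).1 h1
  have γ0 : γ 0 = y := by simp [hγ]
  have hd : HasDerivAt γ J 0 := by
    have := ((Real.hasDerivAt_cos 0).smul_const y).add ((Real.hasDerivAt_sin 0).smul_const J)
    simp at this
    exact this
  have h1 := hasFD hu (inner_mem (hn 0))
  have h2 := h1.comp_hasDerivWithinAt (s := Set.univ) 0 hd.hasDerivWithinAt
    (fun t _ => inner_mem (hn t))
  have h3 : u ∘ γ = fun _ => 0 := by
    funext t; exact inner_bd hb (hn t)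
  rw [h3, γ0, hasDerivWithinAt_univ] at h2
  have h4 := h2.unique (hasDerivAt_const 0 (0:ℝ))
  rw [hJ, map_add, map_smul, map_smul] at h4
  unfold DW
  simp at h4
  linarith

lemma near_bdry {u : E2 → ℝ} (hu : ContDiffOn ℝ 2 u (closure Omega))
    (hb : ∀ x ∈ frontier Omega, u x = 0) (c : E2) (hc : ‖c‖ = 1/2) :
    ∃ δ > 0, ∀ x ∈ Omega, ‖x‖ < 1/2 + δ →
      -1 ≤ TT u x (x 0) (x 1) (x 0 - c 0) (x 1 - c 1) ∧
      nn u ((1 / (2 * ‖x‖)) • x) - 1 ≤ x 0 * D 0 u x + x 1 * D 1 u x := by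
  have k0 := DW_cont hu 0
  have k1 := DW_cont hu 1
  have x0c : ContinuousOn (fun x : E2 => x 0) (closure Omega) := (coord_cd 0).continuous.continuousOn
  have x1c : ContinuousOn (fun x : E2 => x 1) (closure Omega) := (coord_cd 1).continuous.continuousOn
  set F : E2 → ℝ := fun x => (1/2) * (DW 0 u x ^ 2 - DW 1 u x ^ 2) * (x 0 * (x 0 - c 0) - x 1 * (x 1 - c 1))
    + DW 0 u x * DW 1 u x * (x 0 * (x 1 - c 1) + x 1 * (x 0 - c 0)) with hF
  have Fc : ContinuousOn F (closure Omega) := by rw [hF]; fun_prop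
  have Nc : ContinuousOn (nn u) (closure Omega) := by
    have : nn u = fun y => y 0 * DW 0 u y + y 1 * DW 1 u y := by funext y; exact nn_eq u y
    rw [this]; fun_prop
  have uF := closure_compact.uniformContinuousOn_of_continuous Fc
  have uN := closure_compact.uniformContinuousOn_of_continuous Nc
  rw [Metric.uniformContinuousOn_iff] at uF uN
  obtain ⟨δ1, hδ1, h1⟩ := uF 1 one_pos
  obtain ⟨δ2, hδ2, h2⟩ := uN 1 one_pos
  refine ⟨min δ1 δ2, lt_min hδ1 hδ2, ?_⟩
  intro x hx hxd
  have hxp : 0 < ‖x‖ := by linarith [hx.1]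
  set y := (1 / (2 * ‖x‖)) • x with hy
  have ny : ‖y‖ = 1/2 := by
    rw [hy, norm_smul, Real.norm_of_nonneg (by positivity)]; field_simp
  have dxy : dist x y = ‖x‖ - 1/2 := by
    have e : x - y = (1 - 1 / (2 * ‖x‖)) • x := by rw [hy]; module
    have : 0 ≤ 1 - 1 / (2 * ‖x‖) := by
      rw [sub_nonneg, div_le_one (by positivity)]; linarith [hx.1]
    rw [dist_eq_norm, e, norm_smul, Real.norm_of_nonneg this]
    field_simp
  have l1 := h1 x (subset_closure hx) y (inner_mem ny)
    (by rw [dxy]; have := min_le_left δ1 δ2; linarith)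
  have l2 := h2 x (subset_closure hx) y (inner_mem ny)
    (by rw [dxy]; have := min_le_right δ1 δ2; linarith)
  rw [Real.dist_eq, abs_lt] at l1 l2
  constructor
  · have eT : TT u x (x 0) (x 1) (x 0 - c 0) (x 1 - c 1) = F x := by
      rw [hF]; simp only [DW_eq hx]; rfl
    have Fy : 0 ≤ F y := by
      have ht := tang_zero hu hb ny
      set lam := 4 * (DW 0 u y * y 0 + DW 1 u y * y 1) with hlam
      have hy2 := normsq_E2 y
      rw [ny] at hy2
      have p0 : DW 0 u y = lam * y 0 := by
        rw [hlam]; linear_combination (4 * DW 0 u y) * hy2 - (4 * y 1) * ht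
      have p1 : DW 1 u y = lam * y 1 := by
        rw [hlam]; linear_combination (4 * DW 1 u y) * hy2 + (4 * y 0) * ht
      have hc2 := normsq_E2 c
      rw [hc] at hc2
      have hi : 0 ≤ y 0 * (y 0 - c 0) + y 1 * (y 1 - c 1) := by
        nlinarith [sq_nonneg (y 0 - c 0), sq_nonneg (y 1 - c 1)]
      have : F y = (1/2) * lam ^ 2 * (y 0 ^ 2 + y 1 ^ 2) *
          (y 0 * (y 0 - c 0) + y 1 * (y 1 - c 1)) := by
        rw [hF]; simp only; rw [p0, p1]; ring
      rw [this]; positivity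
    rw [eT]; linarith
  · have eN : x 0 * D 0 u x + x 1 * D 1 u x = nn u x := by
      rw [nn_eq, DW_eq hx, DW_eq hx]
    rw [eN]; linarith


/-- outer cutoff profile -/
def BB (p w s : ℝ) : ℝ := smoothTransition ((p + 2 * w - s) / w)
def BB' (p w s : ℝ) : ℝ := -(deriv smoothTransition ((p + 2 * w - s) / w) / w)

lemma BB_deriv (p w s : ℝ) : HasDerivAt (BB p w) (BB' p w s) s := by
  have h1 : HasDerivAt smoothTransition (deriv smoothTransition ((p + 2 * w - s) / w))
      ((p + 2 * w - s) / w) :=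
    (((st_cd 1).differentiable (by norm_num)) _).hasDerivAt
  have h2 : HasDerivAt (fun s : ℝ => (p + 2 * w - s) / w) (-1 / w) s :=
    (((hasDerivAt_id s).const_sub (p + 2 * w)).div_const w)
  have := h1.comp s h2
  have e : BB' p w s = deriv smoothTransition ((p + 2 * w - s) / w) * (-1 / w) := by
    unfold BB'; ring
  rw [e]; exact this

lemma st'_at_zero : deriv smoothTransition 0 = 0 := by
  apply IsLocalMin.deriv_eq_zero
  apply Filter.Eventually.of_forall
  intro t
  rw [smoothTransition.zero_of_nonpos le_rfl]
  exact smoothTransition.nonneg t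

lemma BB'_abs {p w G : ℝ} (hw : 0 < w) (hG : ∀ t, deriv smoothTransition t ≤ G) (s : ℝ) :
    |BB' p w s| ≤ G / w := by
  unfold BB'
  rw [abs_neg, abs_div, abs_of_pos hw, abs_of_nonneg (st'_nonneg _)]
  gcongr; exact hG _

lemma BB'_zero {p w : ℝ} (hw : 0 < w) {x : E2} (h : x ∉ shell (p + w) (p + 2 * w)) :
    BB' p w (‖x‖ ^ 2) = 0 := by
  unfold BB'
  simp only [shell, Set.mem_ofPred_eq, not_and_or, not_le, not_lt] at h
  have : deriv smoothTransition ((p + 2 * w - ‖x‖ ^ 2) / w) = 0 := by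
    rcases h with h | h
    · apply st'_zero; right; rw [one_lt_div hw]; linarith
    · rcases h.lt_or_eq with h | h
      · apply st'_zero; left; exact div_neg_of_neg_of_pos (by linarith) hw
      · rw [← h, sub_self, zero_div, st'_at_zero]
  rw [this]; simp

lemma BB'_cont (p w : ℝ) : Continuous (BB' p w) := by
  unfold BB'
  exact ((st'_cont.comp (by fun_prop)).div_const _).neg

lemma BB_one {p w s : ℝ} (hw : 0 < w) (h : s ≤ p + w) : BB p w s = 1 :=
  smoothTransition.one_of_one_le (by rw [one_le_div hw]; linarith)

lemma BB_zero {p w s : ℝ} (hw : 0 < w) (h : p + 2 * w ≤ s) : BB p w s = 0 :=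
  smoothTransition.zero_of_nonpos (div_nonpos_of_nonpos_of_nonneg (by linarith) hw.le)

/-- full cutoff -/
def HH (ε p w s : ℝ) : ℝ := AA ε s + BB p w s - 1

lemma HH_deriv (ε p w s : ℝ) : HasDerivAt (HH ε p w) (AA' ε s + BB' p w s) s :=
  ((AA_deriv ε s).add (BB_deriv p w s)).sub_const 1

lemma HH_cd (ε p w : ℝ) : ContDiff ℝ 1 (HH ε p w) := by
  unfold HH AA BB
  refine ContDiff.sub (ContDiff.add ?_ ?_) contDiff_const
  · exact (st_cd 1).comp (by fun_prop)
  · exact (st_cd 1).comp (by fun_prop)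

lemma HH_nonneg {ε p w : ℝ} (hε : 0 < ε) (hw : 0 < w) (hp : 1/4 + 2 * ε ≤ p) (s : ℝ) :
    0 ≤ HH ε p w s := by
  unfold HH
  rcases le_total s p with h | h
  · rw [BB_one hw (by linarith)]
    have : 0 ≤ AA ε s := smoothTransition.nonneg _
    linarith
  · rw [AA_one hε (by linarith)]
    have : 0 ≤ BB p w s := smoothTransition.nonneg _
    linarith

lemma HH_zero {ε p w : ℝ} (hε : 0 < ε) (hw : 0 < w) (hp : 1/4 + 2 * ε ≤ p) (s : ℝ)
    (h : s < 1/4 + ε ∨ p + 2 * w < s) : HH ε p w s = 0 := by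
  unfold HH
  rcases h with h | h
  · rw [AA_zero hε h.le, BB_one hw (by linarith)]; ring
  · rw [BB_zero hw h.le, AA_one hε (by linarith)]; ring

lemma HH_one {ε p w s : ℝ} (hε : 0 < ε) (hw : 0 < w) (h1 : 1/4 + 2 * ε ≤ s) (h2 : s ≤ p) :
    HH ε p w s = 1 := by
  unfold HH
  rw [AA_one hε h1, BB_one hw (by linarith)]; ring

lemma TT_smul (v : E2 → ℝ) (x : E2) (c a0 a1 b0 b1 : ℝ) :
    TT v x (c * a0) (c * a1) b0 b1 = c * TT v x a0 a1 b0 b1 := by unfold TT; ring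

lemma coord_abs (x : E2) (i : Fin 2) : |x i| ≤ ‖x‖ := PiLp.norm_apply_le x i

lemma TT_abs {v : E2 → ℝ} {x : E2} {a0 a1 b0 b1 : ℝ} (h0 : |a0| ≤ 1) (h1 : |a1| ≤ 1)
    (k0 : |b0| ≤ 2) (k1 : |b1| ≤ 2) :
    |TT v x a0 a1 b0 b1| ≤ 4 * (D 0 v x ^ 2 + D 1 v x ^ 2) := by
  unfold TT
  have m : ∀ {a b : ℝ}, |a| ≤ 1 → |b| ≤ 2 → |a * b| ≤ 2 := by
    intro a b ha hb
    rw [abs_mul]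
    nlinarith [abs_nonneg a, abs_nonneg b]
  set P := D 0 v x
  set Q := D 1 v x
  have z1 : |a0 * b0 - a1 * b1| ≤ 4 := by
    have := abs_sub (a0 * b0) (a1 * b1)
    have := m h0 k0; have := m h1 k1
    linarith
  have z2 : |a0 * b1 + a1 * b0| ≤ 4 := by
    have := abs_add_le (a0 * b1) (a1 * b0)
    have := m h0 k1; have := m h1 k0
    linarith
  have y1 : |(1/2) * (P ^ 2 - Q ^ 2)| ≤ (1/2) * (P ^ 2 + Q ^ 2) := by
    rw [abs_le]; constructor <;> nlinarith [sq_nonneg P, sq_nonneg Q]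
  have y2 : |P * Q| ≤ (1/2) * (P ^ 2 + Q ^ 2) := by
    rw [abs_le]; constructor <;> nlinarith [sq_nonneg (P - Q), sq_nonneg (P + Q)]
  calc |(1/2) * (P ^ 2 - Q ^ 2) * (a0 * b0 - a1 * b1) + P * Q * (a0 * b1 + a1 * b0)|
      ≤ |(1/2) * (P ^ 2 - Q ^ 2)| * |a0 * b0 - a1 * b1| + |P * Q| * |a0 * b1 + a1 * b0| := by
        rw [← abs_mul, ← abs_mul]; exact abs_add_le _ _
    _ ≤ (1/2) * (P ^ 2 + Q ^ 2) * 4 + (1/2) * (P ^ 2 + Q ^ 2) * 4 := by gcongr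
    _ = _ := by ring

lemma xy_abs {a0 a1 b0 b1 : ℝ} (h0 : |a0| ≤ 1) (h1 : |a1| ≤ 1)
    (k0 : |b0| ≤ 2) (k1 : |b1| ≤ 2) : |b0 * a0 + b1 * a1| ≤ 4 := by
  have m : ∀ {a b : ℝ}, |a| ≤ 1 → |b| ≤ 2 → |b * a| ≤ 2 := by
    intro a b ha hb
    rw [abs_mul]
    nlinarith [abs_nonneg a, abs_nonneg b]
  have := abs_add_le (b0 * a0) (b1 * a1)
  have := m h0 k0; have := m h1 k1
  linarith

lemma xy_nonneg {x x0 : E2} (hx0 : ‖x0‖ = 1/2) (h : 1/4 ≤ ‖x‖ ^ 2) :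
    0 ≤ (x 0 - x0 0) * x 0 + (x 1 - x0 1) * x 1 := by
  have n1 := normsq_E2 x
  have n2 := normsq_E2 x0
  rw [hx0] at n2
  nlinarith [sq_nonneg (x 0 - x0 0), sq_nonneg (x 1 - x0 1)]

lemma AA'_integrable {ε : ℝ} (hε : 0 < ε) : Integrable fun x : E2 => 2 * AA' ε (‖x‖ ^ 2) := by
  have := AA'_cont ε
  apply Continuous.integrable_of_hasCompactSupport (by fun_prop)
  exact (rad_hcs (h := AA' ε) (p := 1/4 + ε) (q := 1/4 + 2 * ε) (fun s hs => AA'_zero hε hs)).mul_left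

lemma AA'_int {ε : ℝ} (hε : 0 < ε) : ∫ x : E2, 2 * AA' ε (‖x‖ ^ 2) = 2 * π := by
  have := polar_int hε (fun _ => 1)
  simpa using this

section est
variable {v V m : E2 → ℝ} {x0 : E2} {L : NNReal} {β a b' ε p w M E G : ℝ}

set_option maxHeartbeats 1600000 in
lemma est1 (hβ : 0 < β) (ha : 0 < a) (hε : 0 < ε) (hε' : 2 * ε ≤ 1/16) (hw : 0 < w) (hp : 9/16 ≤ p)
    (hp' : p + 3 * w ≤ 5/8) (hG : ∀ t, deriv smoothTransition t ≤ G) (hx0 : ‖x0‖ = 1/2)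
    (hV : LipschitzWith L V) (hL : L * (3/2) ≤ a / 2) (hv : ContDiff ℝ 2 v)
    (heq : ∀ x, 1/4 + ε ≤ ‖x‖ ^ 2 → ‖x‖ ^ 2 ≤ 5/8 →
      -lap v x = (1 + rho β x0 x) * V x * Real.exp (v x))
    (hVa : ∀ x, 1/4 + ε ≤ ‖x‖ ^ 2 → ‖x‖ ^ 2 ≤ 5/8 → a ≤ V x ∧ (1 + rho β x0 x) * V x ≤ b')
    (hT : ∀ x, 1/4 + ε ≤ ‖x‖ ^ 2 → ‖x‖ ^ 2 ≤ 1/4 + 2 * ε →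
      -1 ≤ TT v x (x 0) (x 1) (x 0 - x0 0) (x 1 - x0 1))
    (hM : ∫ x in shell (p + w) (p + 2 * w), Real.exp (v x) ≤ M)
    (hE : ∫ x in shell (p + w) (p + 2 * w), (D 0 v x ^ 2 + D 1 v x ^ 2) ≤ E) (hb' : 0 ≤ b') :
    ∫ x, V x * Real.exp (v x) * (2 + 2 * (β + 1) * rho β x0 x) * HH ε p w (‖x‖ ^ 2) ≤
      2 * (2 * π + 8 * (G / w) * (E + b' * M)) := by
  have hG0 : 0 ≤ G := (st'_nonneg 0).trans (hG 0)
  have hp2 : 1/4 + 2 * ε ≤ p := by linarith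
  set η : E2 → ℝ := fun x => HH ε p w (‖x‖ ^ 2) with hη
  have ηcd : ContDiff ℝ 1 η := rad_cd (HH_cd ε p w)
  have ηts := rad_tsupp (HH_zero hε hw hp2)
  have ηc : HasCompactSupport η := rad_hcs (HH_zero hε hw hp2)
  have ηne : ∀ x, η x ≠ 0 → 1/4 + ε ≤ ‖x‖ ^ 2 ∧ ‖x‖ ^ 2 ≤ 5/8 := by
    intro x hx
    have := ηts (subset_tsupport _ hx)
    exact ⟨this.1, by linarith [this.2]⟩
  have Dη : ∀ i x, D i η x = (2 * (AA' ε (‖x‖ ^ 2) + BB' p w (‖x‖ ^ 2))) * x i := by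
    intro i x
    rw [hη, D_rad x (HH_deriv ε p w _)]; ring
  have nx : ∀ x : E2, ‖x‖ ^ 2 ≤ 5/8 → ‖x‖ ≤ 1 ∧ ‖x - x0‖ ≤ 3/2 := by
    intro x hx
    have h1 : ‖x‖ ≤ 1 := by nlinarith [norm_nonneg x]
    exact ⟨h1, (norm_sub_le _ _).trans (by rw [hx0]; linarith)⟩
  have ph := poho (v := v) (η := η) (V := V) x0 hβ hV hv ηcd ηc
    (fun x => HH_nonneg hε hw hp2 _) (fun h => by
      have := (ηts h).1
      rw [hx0] at this; linarith)
    (fun x hx => heq x (ηne x hx).1 (ηne x hx).2)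
    (fun x hx => (hVa x (ηne x hx).1 (ηne x hx).2).1)
    (fun x hx => by
      have := (nx x (ηne x hx).2).2
      have h2 : (L:ℝ) * ‖x - x0‖ ≤ L * (3/2) := by gcongr
      linarith) ha
  have kV := hV.continuous
  have kv := hv.continuous
  have kD := D_cont (hv.of_le (by norm_num : (1:WithTop ℕ∞) ≤ 2))
  have k0 := kD 0
  have k1 := kD 1
  have kDη := D_cont ηcd
  have kη0 := kDη 0
  have kη1 := kDη 1
  have kr := rho_cont hβ x0
  have ky : ∀ i, Continuous (fun x : E2 => x i - x0 i) :=
    fun i => (coord_cd i).continuous.sub continuous_const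
  have I1 : Integrable fun x => TT v x (D 0 η x) (D 1 η x) (x 0 - x0 0) (x 1 - x0 1) := by
    apply Continuous.integrable_of_hasCompactSupport
    · unfold TT; fun_prop
    · apply HasCompactSupport.intro (K := tsupport η) ηc
      intro x hx
      simp [TT, D_supp hx]
  have I2 : Integrable fun x => V x * Real.exp (v x) * (1 + rho β x0 x) *
          ((x 0 - x0 0) * D 0 η x + (x 1 - x0 1) * D 1 η x) := by
    apply Continuous.integrable_of_hasCompactSupport
    · fun_prop
    · apply HasCompactSupport.intro (K := tsupport η) ηc
      intro x hx
      simp [D_supp hx]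
  set A := shell (p + w) (p + 2 * w) with hA
  have mA : MeasurableSet A := shell_meas _ _
  have cg : Continuous fun x => D 0 v x ^ 2 + D 1 v x ^ 2 := by fun_prop
  have ce : Continuous fun x => Real.exp (v x) := by fun_prop
  have J1 : IntegrableOn (fun x => D 0 v x ^ 2 + D 1 v x ^ 2) A := shell_int cg _ _
  have J2 : IntegrableOn (fun x => Real.exp (v x)) A := shell_int ce _ _
  have J3 : IntegrableOn (fun x => 8 * (G / w) * ((D 0 v x ^ 2 + D 1 v x ^ 2) + b' * Real.exp (v x))) A :=
    (J1.add (J2.const_mul b')).const_mul _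
  have bound : (- ∫ x, TT v x (D 0 η x) (D 1 η x) (x 0 - x0 0) (x 1 - x0 1))
      - ∫ x, V x * Real.exp (v x) * (1 + rho β x0 x) *
          ((x 0 - x0 0) * D 0 η x + (x 1 - x0 1) * D 1 η x) ≤
      ∫ x, (2 * AA' ε (‖x‖ ^ 2) +
        A.indicator (fun x => 8 * (G / w) * ((D 0 v x ^ 2 + D 1 v x ^ 2) + b' * Real.exp (v x))) x) := by
    have I1n : Integrable fun x => -TT v x (D 0 η x) (D 1 η x) (x 0 - x0 0) (x 1 - x0 1) := I1.neg
    rw [← integral_neg, ← integral_sub I1n I2]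
    refine integral_mono (I1n.sub I2) ((AA'_integrable hε).add (J3.integrable_indicator mA)) ?_
    intro x
    show -TT v x (D 0 η x) (D 1 η x) (x 0 - x0 0) (x 1 - x0 1) -
      V x * Real.exp (v x) * (1 + rho β x0 x) *
          ((x 0 - x0 0) * D 0 η x + (x 1 - x0 1) * D 1 η x) ≤ 2 * AA' ε (‖x‖ ^ 2) +
        A.indicator (fun x => 8 * (G / w) * ((D 0 v x ^ 2 + D 1 v x ^ 2) + b' * Real.exp (v x))) x
    rw [Dη, Dη, TT_smul]
    set T := TT v x (x 0) (x 1) (x 0 - x0 0) (x 1 - x0 1) with hTdef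
    set xy := (x 0 - x0 0) * x 0 + (x 1 - x0 1) * x 1 with hxy
    have hexp := Real.exp_pos (v x)
    have p1 : -(AA' ε (‖x‖ ^ 2) * (2 * (T + V x * Real.exp (v x) * (1 + rho β x0 x) * xy))) ≤
        2 * AA' ε (‖x‖ ^ 2) := by
      by_cases hz : AA' ε (‖x‖ ^ 2) = 0
      · rw [hz]; simp
      · have hr : 1/4 + ε ≤ ‖x‖ ^ 2 ∧ ‖x‖ ^ 2 ≤ 1/4 + 2 * ε := by
          by_contra hc
          apply hz
          apply AA'_zero hε
          rw [not_and_or, not_le, not_le] at hc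
          exact hc
        have h1 := hT x hr.1 hr.2
        have h2 := (hVa x hr.1 (by linarith)).1
        have h3 : 0 ≤ xy := xy_nonneg hx0 (by linarith [hr.1])
        have h4 := rho_nonneg β x0 x
        have h5 : 0 ≤ V x * Real.exp (v x) * (1 + rho β x0 x) * xy := by
          have : 0 < V x := by linarith
          positivity
        have h6 := AA'_nonneg hε (‖x‖ ^ 2)
        nlinarith
    have p2 : -(BB' p w (‖x‖ ^ 2) * (2 * (T + V x * Real.exp (v x) * (1 + rho β x0 x) * xy))) ≤
        A.indicator (fun x => 8 * (G / w) * ((D 0 v x ^ 2 + D 1 v x ^ 2) + b' * Real.exp (v x))) x := by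
      by_cases hxA : x ∈ A
      · rw [Set.indicator_of_mem hxA]
        have hs1 : 1/4 + ε ≤ ‖x‖ ^ 2 := by have := hxA.1; linarith
        have hs2 : ‖x‖ ^ 2 ≤ 5/8 := by have := hxA.2; linarith
        obtain ⟨q1, q2⟩ := nx x hs2
        have c0 := (coord_abs x 0).trans q1
        have c1 := (coord_abs x 1).trans q1
        have e0 : |x 0 - x0 0| ≤ 2 := by
          have := coord_abs (x - x0) 0
          simp only [PiLp.sub_apply] at this; linarith
        have e1 : |x 1 - x0 1| ≤ 2 := by
          have := coord_abs (x - x0) 1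
          simp only [PiLp.sub_apply] at this; linarith
        have t1 : |T| ≤ 4 * (D 0 v x ^ 2 + D 1 v x ^ 2) := TT_abs c0 c1 e0 e1
        have t2 : |xy| ≤ 4 := xy_abs c0 c1 e0 e1
        obtain ⟨v1, v2⟩ := hVa x hs1 hs2
        have r0 := rho_nonneg β x0 x
        have t3 : |V x * Real.exp (v x) * (1 + rho β x0 x) * xy| ≤ 4 * (b' * Real.exp (v x)) := by
          rw [abs_mul, abs_of_nonneg (by have : 0 < V x := by linarith
                                         positivity)]
          have : V x * Real.exp (v x) * (1 + rho β x0 x) ≤ b' * Real.exp (v x) := by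
            have := mul_le_mul_of_nonneg_right v2 hexp.le
            linarith
          have h9 : 0 ≤ b' * Real.exp (v x) := by positivity
          calc _ ≤ b' * Real.exp (v x) * 4 := mul_le_mul this t2 (abs_nonneg _) h9
            _ = _ := by ring
        have t4 := BB'_abs (p := p) hw hG (‖x‖ ^ 2)
        calc _ ≤ |BB' p w (‖x‖ ^ 2) * (2 * (T + V x * Real.exp (v x) * (1 + rho β x0 x) * xy))| :=
              neg_le_abs _
          _ = |BB' p w (‖x‖ ^ 2)| * (2 * |T + V x * Real.exp (v x) * (1 + rho β x0 x) * xy|) := by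
              rw [abs_mul, abs_mul, abs_two]
          _ ≤ (G / w) * (2 * (4 * (D 0 v x ^ 2 + D 1 v x ^ 2) + 4 * (b' * Real.exp (v x)))) := by
              have := (abs_add_le T (V x * Real.exp (v x) * (1 + rho β x0 x) * xy)).trans
                (add_le_add t1 t3)
              have hGw : 0 ≤ G / w := by positivity
              gcongr
          _ = _ := by ring
      · rw [Set.indicator_of_notMem hxA, BB'_zero hw hxA]; simp
    calc _ = -(AA' ε (‖x‖ ^ 2) * (2 * (T + V x * Real.exp (v x) * (1 + rho β x0 x) * xy))) +
          -(BB' p w (‖x‖ ^ 2) * (2 * (T + V x * Real.exp (v x) * (1 + rho β x0 x) * xy))) := by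
          rw [hxy]; ring
      _ ≤ _ := add_le_add p1 p2
  rw [integral_add (AA'_integrable hε) (J3.integrable_indicator mA), AA'_int hε,
    integral_indicator mA, integral_const_mul, integral_add J1 (J2.const_mul b'),
    integral_const_mul] at bound
  have hGw : 0 ≤ G / w := by positivity
  have fin : 8 * (G / w) * ((∫ x in A, (D 0 v x ^ 2 + D 1 v x ^ 2)) + b' * ∫ x in A, Real.exp (v x)) ≤
      8 * (G / w) * (E + b' * M) := by gcongr
  linarith


set_option maxHeartbeats 1600000 in
lemma est2 (hβ : 0 < β) (ha : 0 < a) (hε : 0 < ε) (hε' : 2 * ε ≤ 1/16) (hw : 0 < w) (hp : 9/16 ≤ p)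
    (hp' : p + 3 * w ≤ 5/8) (hG : ∀ t, deriv smoothTransition t ≤ G)
    (hV : Continuous V) (hv : ContDiff ℝ 2 v) (hv0 : ∀ x, 0 ≤ v x)
    (heq : ∀ x, 1/4 + ε ≤ ‖x‖ ^ 2 → ‖x‖ ^ 2 ≤ 5/8 →
      -lap v x = (1 + rho β x0 x) * V x * Real.exp (v x))
    (hVa : ∀ x, 1/4 + ε ≤ ‖x‖ ^ 2 → ‖x‖ ^ 2 ≤ 5/8 → a ≤ V x)
    (hm : ∀ x : E2, 1/4 + ε ≤ ‖x‖ ^ 2 → ‖x‖ ^ 2 ≤ 1/4 + 2 * ε →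
      0 ≤ m ((1/(2*‖x‖)) • x) ∧ m ((1/(2*‖x‖)) • x) - 1 ≤ x 0 * D 0 v x + x 1 * D 1 v x)
    (hM : ∫ x in shell (p + w) (p + 2 * w), Real.exp (v x) ≤ M)
    (hE : ∫ x in shell (p + w) (p + 2 * w), (D 0 v x ^ 2 + D 1 v x ^ 2) ≤ E) :
    ∫ θ in (0:ℝ)..(2 * π), m (circlePt (1/2) θ) ≤
      (∫ x, V x * Real.exp (v x) * (2 + 2 * (β + 1) * rho β x0 x) * HH ε p w (‖x‖ ^ 2)) +
      2 * π + 2 * (G / w) * (E + M) := by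
  have hG0 : 0 ≤ G := (st'_nonneg 0).trans (hG 0)
  have hGw : 0 ≤ G / w := by positivity
  have hp2 : 1/4 + 2 * ε ≤ p := by linarith
  set η : E2 → ℝ := fun x => HH ε p w (‖x‖ ^ 2) with hη
  have ηcd : ContDiff ℝ 1 η := rad_cd (HH_cd ε p w)
  have ηts := rad_tsupp (HH_zero hε hw hp2)
  have ηc : HasCompactSupport η := rad_hcs (HH_zero hε hw hp2)
  have η0 : ∀ x, 0 ≤ η x := fun x => HH_nonneg hε hw hp2 _
  have ηne : ∀ x, η x ≠ 0 → 1/4 + ε ≤ ‖x‖ ^ 2 ∧ ‖x‖ ^ 2 ≤ 5/8 := by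
    intro x hx
    have := ηts (subset_tsupport _ hx)
    exact ⟨this.1, by linarith [this.2]⟩
  have Dη : ∀ i x, D i η x = (2 * (AA' ε (‖x‖ ^ 2) + BB' p w (‖x‖ ^ 2))) * x i := by
    intro i x
    rw [hη, D_rad x (HH_deriv ε p w _)]; ring
  have kv := hv.continuous
  have kD := D_cont (hv.of_le (by norm_num : (1:WithTop ℕ∞) ≤ 2))
  have k0 := kD 0
  have k1 := kD 1
  have kDη := D_cont ηcd
  have kη0 := kDη 0
  have kη1 := kDη 1
  have kη := ηcd.continuous
  have kr := rho_cont hβ x0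
  have wk := weak hv ηcd ηc
  set A := shell (p + w) (p + 2 * w) with hA
  have mA : MeasurableSet A := shell_meas _ _
  have cg : Continuous fun x => D 0 v x ^ 2 + D 1 v x ^ 2 := by fun_prop
  have ce : Continuous fun x => Real.exp (v x) := by fun_prop
  have J1 : IntegrableOn (fun x => D 0 v x ^ 2 + D 1 v x ^ 2) A := shell_int cg _ _
  have J2 : IntegrableOn (fun x => Real.exp (v x)) A := shell_int ce _ _
  have J3 : IntegrableOn (fun x => 2 * (G / w) * ((D 0 v x ^ 2 + D 1 v x ^ 2) + Real.exp (v x))) A :=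
    (J1.add J2).const_mul _
  have I1 : Integrable fun x => D 0 v x * D 0 η x + D 1 v x * D 1 η x := by
    apply Continuous.integrable_of_hasCompactSupport
    · fun_prop
    · apply HasCompactSupport.intro (K := tsupport η) ηc
      intro x hx
      simp [D_supp hx]
  have I2 : Integrable fun x => V x * Real.exp (v x) * (2 + 2 * (β + 1) * rho β x0 x) * η x := by
    apply Continuous.integrable_of_hasCompactSupport
    · fun_prop
    · apply HasCompactSupport.intro (K := tsupport η) ηc
      intro x hx
      simp [image_eq_zero_of_notMem_tsupport hx]
  have s1 : ∫ x, (D 0 v x * D 0 η x + D 1 v x * D 1 η x) ≤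
      ∫ x, V x * Real.exp (v x) * (2 + 2 * (β + 1) * rho β x0 x) * η x := by
    rw [← wk]
    refine integral_mono_of_nonneg (Filter.Eventually.of_forall fun x => ?_) I2
      (Filter.Eventually.of_forall fun x => ?_)
    · show 0 ≤ -lap v x * η x
      by_cases hz : η x = 0
      · rw [hz]; simp
      · obtain ⟨h1, h2⟩ := ηne x hz
        have := hVa x h1 h2
        have : 0 < V x := by linarith
        have := rho_nonneg β x0 x
        have := η0 x
        rw [heq x h1 h2]; positivity
    · show -lap v x * η x ≤ V x * Real.exp (v x) * (2 + 2 * (β + 1) * rho β x0 x) * η x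
      by_cases hz : η x = 0
      · rw [hz]; simp
      · obtain ⟨h1, h2⟩ := ηne x hz
        have := hVa x h1 h2
        have : 0 < V x := by linarith
        have hr := rho_nonneg β x0 x
        rw [heq x h1 h2]
        apply mul_le_mul_of_nonneg_right _ (η0 x)
        have h3 : 1 + rho β x0 x ≤ 2 + 2 * (β + 1) * rho β x0 x := by nlinarith
        calc _ = V x * Real.exp (v x) * (1 + rho β x0 x) := by ring
          _ ≤ _ := by gcongr
  have I12 : Integrable fun x => 2 * AA' ε (‖x‖ ^ 2) + (D 0 v x * D 0 η x + D 1 v x * D 1 η x) :=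
    (AA'_integrable hε).add I1
  have s2 : ∫ x : E2, 2 * AA' ε (‖x‖ ^ 2) * m ((1/(2*‖x‖)) • x) ≤
      ∫ x, ((2 * AA' ε (‖x‖ ^ 2) + (D 0 v x * D 0 η x + D 1 v x * D 1 η x)) +
        A.indicator (fun x => 2 * (G / w) * ((D 0 v x ^ 2 + D 1 v x ^ 2) + Real.exp (v x))) x) := by
    refine integral_mono_of_nonneg (Filter.Eventually.of_forall fun x => ?_)
      (I12.add (J3.integrable_indicator mA)) (Filter.Eventually.of_forall fun x => ?_)
    · show 0 ≤ 2 * AA' ε (‖x‖ ^ 2) * m ((1/(2*‖x‖)) • x)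
      by_cases hz : AA' ε (‖x‖ ^ 2) = 0
      · rw [hz]; simp
      · have hr : 1/4 + ε ≤ ‖x‖ ^ 2 ∧ ‖x‖ ^ 2 ≤ 1/4 + 2 * ε := by
          by_contra hc
          apply hz
          apply AA'_zero hε
          rw [not_and_or, not_le, not_le] at hc
          exact hc
        have := (hm x hr.1 hr.2).1
        have := AA'_nonneg hε (‖x‖ ^ 2)
        positivity
    · show 2 * AA' ε (‖x‖ ^ 2) * m ((1/(2*‖x‖)) • x) ≤
        (2 * AA' ε (‖x‖ ^ 2) + (D 0 v x * D 0 η x + D 1 v x * D 1 η x)) +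
        A.indicator (fun x => 2 * (G / w) * ((D 0 v x ^ 2 + D 1 v x ^ 2) + Real.exp (v x))) x
      rw [Dη, Dη]
      set S := x 0 * D 0 v x + x 1 * D 1 v x with hS
      have p1 : 2 * AA' ε (‖x‖ ^ 2) * m ((1/(2*‖x‖)) • x) ≤
          2 * AA' ε (‖x‖ ^ 2) + 2 * AA' ε (‖x‖ ^ 2) * S := by
        by_cases hz : AA' ε (‖x‖ ^ 2) = 0
        · rw [hz]; simp
        · have hr : 1/4 + ε ≤ ‖x‖ ^ 2 ∧ ‖x‖ ^ 2 ≤ 1/4 + 2 * ε := by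
            by_contra hc
            apply hz
            apply AA'_zero hε
            rw [not_and_or, not_le, not_le] at hc
            exact hc
          have h1 := (hm x hr.1 hr.2).2
          have h2 := AA'_nonneg hε (‖x‖ ^ 2)
          nlinarith
      have p2 : -(2 * BB' p w (‖x‖ ^ 2) * S) ≤
          A.indicator (fun x => 2 * (G / w) * ((D 0 v x ^ 2 + D 1 v x ^ 2) + Real.exp (v x))) x := by
        by_cases hxA : x ∈ A
        · rw [Set.indicator_of_mem hxA]
          have hs2 : ‖x‖ ^ 2 ≤ 5/8 := by have := hxA.2; linarith
          have q1 : x 0 ^ 2 + x 1 ^ 2 ≤ 1 := by rw [← normsq_E2]; linarith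
          have he : 1 ≤ Real.exp (v x) := Real.one_le_exp (hv0 x)
          have t1 : |S| ≤ (D 0 v x ^ 2 + D 1 v x ^ 2) + Real.exp (v x) := by
            rw [abs_le, hS]
            constructor
            · nlinarith [sq_nonneg (x 0 + D 0 v x), sq_nonneg (x 1 + D 1 v x)]
            · nlinarith [sq_nonneg (x 0 - D 0 v x), sq_nonneg (x 1 - D 1 v x)]
          have t4 := BB'_abs (p := p) hw hG (‖x‖ ^ 2)
          calc _ ≤ |2 * BB' p w (‖x‖ ^ 2) * S| := neg_le_abs _
            _ = 2 * |BB' p w (‖x‖ ^ 2)| * |S| := by rw [abs_mul, abs_mul, abs_two]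
            _ ≤ _ := by gcongr
        · rw [Set.indicator_of_notMem hxA, BB'_zero hw hxA]; simp
      have e : D 0 v x * (2 * (AA' ε (‖x‖ ^ 2) + BB' p w (‖x‖ ^ 2)) * x 0) +
          D 1 v x * (2 * (AA' ε (‖x‖ ^ 2) + BB' p w (‖x‖ ^ 2)) * x 1) =
          2 * AA' ε (‖x‖ ^ 2) * S + 2 * BB' p w (‖x‖ ^ 2) * S := by rw [hS]; ring
      rw [e]
      linarith
  rw [polar_int hε, integral_add I12 (J3.integrable_indicator mA),
    integral_add (AA'_integrable hε) I1, AA'_int hε,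
    integral_indicator mA, integral_const_mul, integral_add J1 J2] at s2
  have fin : 2 * (G / w) * ((∫ x in A, (D 0 v x ^ 2 + D 1 v x ^ 2)) + ∫ x in A, Real.exp (v x)) ≤
      2 * (G / w) * (E + M) := by gcongr
  linarith

end est


lemma mem_Omega_sq {x : E2} (h1 : 1/4 < ‖x‖ ^ 2) (h2 : ‖x‖ ^ 2 < 1) : x ∈ Omega := by
  refine ⟨?_, ?_⟩
  · by_contra h
    push Not at h
    nlinarith [norm_nonneg x]
  · by_contra h
    push Not at h
    nlinarith [norm_nonneg x]

lemma glob {u : E2 → ℝ} (hu : ContDiffOn ℝ 2 u (closure Omega)) (h0 : ∀ x ∈ closure Omega, 0 ≤ u x)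
    {ε : ℝ} (hε : 0 < ε) : ∃ v : E2 → ℝ, ContDiff ℝ 2 v ∧ (∀ x, 0 ≤ v x) ∧
      ∀ x, 1/4 + ε ≤ ‖x‖ ^ 2 → ‖x‖ ^ 2 ≤ 7/8 → v =ᶠ[nhds x] u := by
  have hε4 : 0 < ε / 4 := by linarith
  have h32 : (0:ℝ) < 1/32 := by norm_num
  have ts := rad_tsupp (h := bmp (1/4 + ε/4) (ε/4) (15/16) (1/32)) (p := 1/4 + ε/4) (q := 15/16)
    (fun s hs => bmp_zero hε4 h32 (hs.imp le_of_lt le_of_lt))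
  set χ : E2 → ℝ := fun x => bmp (1/4 + ε/4) (ε/4) (15/16) (1/32) (‖x‖ ^ 2) with hχ
  have χcd : ContDiff ℝ 2 χ := rad_cd (bmp_cd _ _ _ _ 2)
  have inO : ∀ x, x ∈ tsupport χ → x ∈ Omega := by
    intro x hx
    have h := ts hx
    exact mem_Omega_sq (by linarith [h.1]) (by linarith [h.2])
  refine ⟨fun x => χ x * u x, ?_, ?_, ?_⟩
  · rw [contDiff_iff_contDiffAt]
    intro x
    by_cases hx : x ∈ tsupport χ
    · exact χcd.contDiffAt.mul (sol_cda hu (inO x hx))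
    · have : (fun x => χ x * u x) =ᶠ[nhds x] fun _ => 0 := by
        filter_upwards [(isClosed_tsupport χ).isOpen_compl.mem_nhds hx] with y hy
        rw [image_eq_zero_of_notMem_tsupport hy, zero_mul]
      exact contDiffAt_const.congr_of_eventuallyEq this
  · intro x
    by_cases hx : x ∈ tsupport χ
    · exact mul_nonneg (bmp_nonneg _ _ _ _ _) (h0 x (subset_closure (inO x hx)))
    · show 0 ≤ χ x * u x
      rw [image_eq_zero_of_notMem_tsupport hx, zero_mul]
  · intro x h1 h2
    have c : Continuous fun y : E2 => ‖y‖ ^ 2 := by fun_prop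
    filter_upwards [c.continuousAt.eventually (lt_mem_nhds (show 1/4 + ε/2 < ‖x‖ ^ 2 by linarith)),
      c.continuousAt.eventually (gt_mem_nhds (show ‖x‖ ^ 2 < 29/32 by linarith))] with y hy1 hy2
    have : χ y = 1 := bmp_one hε4 h32 (by linarith) (by linarith)
    rw [this, one_mul]

lemma lap_congr {f g : E2 → ℝ} {x : E2} (h : f =ᶠ[nhds x] g) : lap f x = lap g x := by
  unfold lap
  rw [(h.iteratedFDeriv ℝ 2).eq_of_nhds]

lemma TT_congr {f g : E2 → ℝ} {x : E2} (h : f =ᶠ[nhds x] g) (a0 a1 b0 b1 : ℝ) :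
    TT f x a0 a1 b0 b1 = TT g x a0 a1 b0 b1 := by
  unfold TT
  rw [D_congr h, D_congr h]

lemma two_rpow_ge {β : ℝ} (hβ : 0 < β) : (1:ℝ) ≤ 2 ^ (2 * β) :=
  Real.one_le_rpow (by norm_num) (by linarith)

lemma rho_le {β : ℝ} (hβ : 0 < β) {x0 x : E2} (hx0 : ‖x0‖ = 1/2) (hx : ‖x‖ ≤ 1) :
    rho β x0 x ≤ 2 ^ (2 * β) := by
  unfold rho
  apply Real.rpow_le_rpow (norm_nonneg _) _ (by linarith)
  exact (norm_sub_le _ _).trans (by rw [hx0]; linarith)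

/-- the two bounds, for every small cutoff parameter -/
lemma core_est (β a b : ℝ) (hβ : 0 < β) (ha : 0 < a) (hab : a ≤ b) :
    ∃ C1 C2 : ℝ, ∀ (x0 : E2), ‖x0‖ = 1/2 → ∀ V u : E2 → ℝ,
      LipschitzOnWith (Real.toNNReal (a / (2 * (1 + (2:ℝ) ^ (2 * β))))) V (closure Omega) →
      (∀ x ∈ closure Omega, a ≤ V x ∧ V x ≤ b) → IsSolP β x0 V u →
      (∀ x ∈ closure Omega, 0 ≤ u x) →
      ∃ ε0 > 0, ∀ ε, 0 < ε → ε < ε0 →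
        ∫ x in shell (1/4 + 2 * ε) (9/16),
          (2 + 2 * (β + 1) * ‖x - x0‖ ^ (2 * β)) * V x * Real.exp (u x) ≤ C1 ∧
        ∫ θ in (0:ℝ)..(2 * π), nn u (circlePt (1/2) θ) ≤ C2 := by
  have hK := two_rpow_ge hβ
  set K : ℝ := 2 ^ (2 * β) with hKdef
  have hb : 0 < b := by linarith
  have hb' : 0 < (1 + K) * b := by positivity
  obtain ⟨w, M, E, N, hw, hM0, hE0, hint⟩ := interior_est ha hb'
  obtain ⟨G, hG0, hG⟩ := st'_bdd
  refine ⟨2 * (2 * π + 8 * (G / w) * (E + ((1 + K) * b) * M)),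
    2 * (2 * π + 8 * (G / w) * (E + ((1 + K) * b) * M)) + 2 * π + 2 * (G / w) * (E + M), ?_⟩
  intro x0 hx0 V u hVL hVb hsol h0
  obtain ⟨hu, hbd, hPDE⟩ := hsol
  obtain ⟨W, hWL, hWV⟩ := hVL.extend_real
  obtain ⟨δ, hδ, hnear⟩ := near_bdry hu hbd x0 hx0
  refine ⟨min (1/32) (δ/2), by positivity, ?_⟩
  intro ε hε hεlt
  have hε1 : ε < 1/32 := lt_of_lt_of_le hεlt (min_le_left _ _)
  have hε2 : ε < δ/2 := lt_of_lt_of_le hεlt (min_le_right _ _)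
  obtain ⟨v, hv, hv0, hvu⟩ := glob hu h0 hε
  have inO : ∀ x : E2, 1/4 + ε ≤ ‖x‖ ^ 2 → ‖x‖ ^ 2 ≤ 7/8 → x ∈ Omega :=
    fun x h1 h2 => mem_Omega_sq (by linarith) (by linarith)
  have heq : ∀ x : E2, 1/4 + ε ≤ ‖x‖ ^ 2 → ‖x‖ ^ 2 ≤ 7/8 →
      -lap v x = (1 + rho β x0 x) * W x * Real.exp (v x) := by
    intro x h1 h2
    have hO := inO x h1 h2
    rw [lap_congr (hvu x h1 h2), hPDE x hO, (hvu x h1 h2).eq_of_nhds, ← hWV (subset_closure hO)]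
    rfl
  have hWa : ∀ x : E2, 1/4 + ε ≤ ‖x‖ ^ 2 → ‖x‖ ^ 2 ≤ 7/8 →
      a ≤ W x ∧ (1 + rho β x0 x) * W x ≤ (1 + K) * b := by
    intro x h1 h2
    have hO := inO x h1 h2
    have h3 := hVb x (subset_closure hO)
    rw [hWV (subset_closure hO)] at h3
    have h4 := rho_le hβ hx0 hO.2.le
    have h5 := rho_nonneg β x0 x
    refine ⟨h3.1, ?_⟩
    have : 0 ≤ W x := by linarith [h3.1]
    exact mul_le_mul (by linarith) h3.2 this (by linarith)
  obtain ⟨p, hp, hp', hMi, hEi⟩ := hint v hv hv0 (by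
    intro x h1 h2
    have h1' : 1/4 + ε ≤ ‖x‖ ^ 2 := by linarith
    rw [heq x h1' h2]
    obtain ⟨h3, h4⟩ := hWa x h1' h2
    have h5 := rho_nonneg β x0 x
    have h6 := Real.exp_pos (v x)
    refine ⟨mul_le_mul_of_nonneg_right ?_ h6.le, mul_le_mul_of_nonneg_right h4 h6.le⟩
    nlinarith)
  have hL : (Real.toNNReal (a / (2 * (1 + K))) : ℝ) * (3/2) ≤ a / 2 := by
    rw [Real.coe_toNNReal _ (by positivity)]
    have : a / (2 * (1 + K)) ≤ a / 4 := by
      apply div_le_div_of_nonneg_left ha.le (by norm_num) (by linarith)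
    linarith
  have nearO : ∀ x : E2, 1/4 + ε ≤ ‖x‖ ^ 2 → ‖x‖ ^ 2 ≤ 1/4 + 2 * ε → x ∈ Omega ∧ ‖x‖ < 1/2 + δ := by
    intro x h1 h2
    refine ⟨inO x h1 (by linarith), ?_⟩
    by_contra hc
    push Not at hc
    nlinarith [norm_nonneg x]
  have e1 := est1 (v := v) (V := W) (x0 := x0) hβ ha hε (by linarith) hw hp hp' hG hx0 hWL hL hv
    (fun x h1 h2 => heq x h1 (by linarith)) (fun x h1 h2 => hWa x h1 (by linarith))
    (fun x h1 h2 => by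
      obtain ⟨k1, k2⟩ := nearO x h1 h2
      rw [TT_congr (hvu x h1 (by linarith))]
      exact (hnear x k1 k2).1) hMi hEi hb'.le
  have e2 := est2 (v := v) (V := W) (x0 := x0) (m := nn u) hβ ha hε (by linarith) hw hp hp' hG
    hWL.continuous hv hv0
    (fun x h1 h2 => heq x h1 (by linarith)) (fun x h1 h2 => (hWa x h1 (by linarith)).1)
    (fun x h1 h2 => by
      obtain ⟨k1, k2⟩ := nearO x h1 h2
      rw [D_congr (hvu x h1 (by linarith)), D_congr (hvu x h1 (by linarith))]
      refine ⟨nn_nonneg hu hbd h0 ?_, (hnear x k1 k2).2⟩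
      have : 0 < ‖x‖ := by linarith [k1.1]
      rw [norm_smul, Real.norm_of_nonneg (by positivity)]
      field_simp) hMi hEi
  refine ⟨?_, by linarith⟩
  refine le_trans ?_ e1
  have hp2 : 1/4 + 2 * ε ≤ p := by linarith
  have hz := HH_zero hε hw hp2
  have Hcd : ContDiff ℝ 1 (fun x : E2 => HH ε p w (‖x‖ ^ 2)) := rad_cd (HH_cd ε p w)
  have kH := Hcd.continuous
  have kW := hWL.continuous
  have kv := hv.continuous
  have kr := rho_cont hβ x0
  have I : Integrable fun x => W x * Real.exp (v x) * (2 + 2 * (β + 1) * rho β x0 x) *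
      HH ε p w (‖x‖ ^ 2) := by
    apply Continuous.integrable_of_hasCompactSupport
    · fun_prop
    · exact HasCompactSupport.mul_left (rad_hcs hz)
  have e3 : ∫ x in shell (1/4 + 2 * ε) (9/16),
      (2 + 2 * (β + 1) * ‖x - x0‖ ^ (2 * β)) * V x * Real.exp (u x) =
      ∫ x in shell (1/4 + 2 * ε) (9/16), W x * Real.exp (v x) * (2 + 2 * (β + 1) * rho β x0 x) *
      HH ε p w (‖x‖ ^ 2) := by
    apply setIntegral_congr_fun (shell_meas _ _)
    intro x hx
    have h1 := hx.1
    have h2 := hx.2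
    have hO := inO x (by linarith) (by linarith)
    show (2 + 2 * (β + 1) * ‖x - x0‖ ^ (2 * β)) * V x * Real.exp (u x) =
      W x * Real.exp (v x) * (2 + 2 * (β + 1) * rho β x0 x) * HH ε p w (‖x‖ ^ 2)
    rw [HH_one hε hw h1 (by linarith), hWV (subset_closure hO),
      (hvu x (by linarith) (by linarith)).eq_of_nhds]
    unfold rho; ring
  rw [e3]
  refine setIntegral_le_integral I (Filter.Eventually.of_forall fun x => ?_)
  show 0 ≤ W x * Real.exp (v x) * (2 + 2 * (β + 1) * rho β x0 x) * HH ε p w (‖x‖ ^ 2)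
  by_cases hH : HH ε p w (‖x‖ ^ 2) = 0
  · rw [hH]; simp
  · have hr : 1/4 + ε ≤ ‖x‖ ^ 2 ∧ ‖x‖ ^ 2 ≤ p + 2 * w := by
      by_contra hc
      rw [not_and_or, not_le, not_le] at hc
      exact hH (hz _ hc)
    have h3 := (hWa x hr.1 (by linarith [hr.2])).1
    have : 0 < W x := by linarith
    have := rho_nonneg β x0 x
    have := HH_nonneg hε hw hp2 (‖x‖ ^ 2)
    positivity

lemma shell_limit {F : E2 → ℝ} (hF : ContinuousOn F (closure Omega)) {C1 ε0 : ℝ} (h0 : 0 < ε0)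
    (h : ∀ ε, 0 < ε → ε < ε0 → ∫ x in shell (1/4 + 2 * ε) (9/16), F x ≤ C1) :
    ∫ x in ann (1/2) (3/4), F x ≤ C1 := by
  set s : ℕ → Set E2 := fun n => shell (1/4 + 2 * (ε0 / (n + 2))) (9/16) with hs
  have hpos : ∀ n : ℕ, 0 < ε0 / ((n:ℝ) + 2) := fun n => by positivity
  have hU : (⋃ n, s n) = ann (1/2) (3/4) := by
    ext x
    have nn0 := norm_nonneg x
    simp only [Set.mem_iUnion]
    constructor
    · rintro ⟨n, hn⟩
      have h1 := hn.1
      have h2 := hn.2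
      have := hpos n
      refine ⟨?_, ?_⟩
      · by_contra hc
        push Not at hc
        nlinarith
      · by_contra hc
        push Not at hc
        nlinarith
    · rintro ⟨h1, h2⟩
      have h3 : 0 < ‖x‖ ^ 2 - 1/4 := by nlinarith
      obtain ⟨n, hn⟩ := exists_nat_gt (2 * ε0 / (‖x‖ ^ 2 - 1/4))
      refine ⟨n, ?_, by nlinarith⟩
      rw [div_lt_iff₀ h3] at hn
      have h4 : 2 * (ε0 / ((n:ℝ) + 2)) ≤ ‖x‖ ^ 2 - 1/4 := by
        rw [← mul_div_assoc, div_le_iff₀ (by positivity)]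
        nlinarith
      linarith
  have hmono : Monotone s := by
    intro m n hmn x hx
    refine ⟨le_trans ?_ hx.1, hx.2⟩
    have : (m:ℝ) ≤ n := by exact_mod_cast hmn
    gcongr
  have hi : IntegrableOn F (⋃ n, s n) := by
    rw [hU]
    apply (hF.integrableOn_compact closure_compact).mono_set
    intro x hx
    exact subset_closure ⟨hx.1, hx.2.trans (by norm_num)⟩
  have := tendsto_setIntegral_of_monotone (fun n => shell_meas _ _) hmono hi
  rw [hU] at this
  refine le_of_tendsto' this fun n => h _ (hpos n) ?_
  rw [div_lt_iff₀ (by positivity)]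
  nlinarith [(Nat.cast_nonneg n : (0:ℝ) ≤ n)]

lemma circlePt_cont : Continuous fun θ : ℝ => circlePt (1/2) θ := by
  unfold circlePt
  apply (PiLp.continuous_toLp 2 _).comp
  apply continuous_pi
  intro i
  fin_cases i
  · show Continuous fun θ : ℝ => 1/2 * Real.cos θ
    fun_prop
  · show Continuous fun θ : ℝ => 1/2 * Real.sin θ
    fun_prop

lemma nn_circ_cont {u : E2 → ℝ} (hu : ContDiffOn ℝ 2 u (closure Omega)) :
    Continuous fun θ : ℝ => nn u (circlePt (1/2) θ) := by
  have hm : ∀ θ, circlePt (1/2) θ ∈ closure Omega :=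
    fun θ => inner_mem (norm_circlePt (by norm_num) θ)
  have hD : ∀ i, Continuous fun θ : ℝ => DW i u (circlePt (1/2) θ) :=
    fun i => (DW_cont hu i).comp_continuous circlePt_cont hm
  have hc : ∀ i, Continuous fun θ : ℝ => circlePt (1/2) θ i :=
    fun i => (coord_cd i).continuous.comp circlePt_cont
  simp only [nn_eq]
  exact ((hc 0).mul (hD 0)).add ((hc 1).mul (hD 1))

lemma flux_le {u : E2 → ℝ} (hu : ContDiffOn ℝ 2 u (closure Omega))
    (hb : ∀ x ∈ frontier Omega, u x = 0) (h0 : ∀ x ∈ closure Omega, 0 ≤ u x) :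
    |circleIntR (fun x => ⟪gradient u x, (-2 : ℝ) • x⟫) (1/2)| ≤
      ∫ θ in (0:ℝ)..(2 * π), nn u (circlePt (1/2) θ) := by
  unfold circleIntR
  rw [← Real.norm_eq_abs]
  apply intervalIntegral.norm_integral_le_of_norm_le (by positivity)
  · refine Filter.Eventually.of_forall fun θ _ => ?_
    set y := circlePt (1/2) θ with hy
    have hny : ‖y‖ = 1/2 := norm_circlePt (by norm_num) θ
    have hn := nn_nonneg hu hb h0 hny
    show ‖⟪gradient u y, (-2 : ℝ) • y⟫ * (1/2)‖ ≤ nn u y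
    by_cases hd : DifferentiableAt ℝ u y
    · have e : ⟪gradient u y, y⟫ = nn u y := by
        unfold gradient nn
        rw [InnerProductSpace.toDual_symm_apply,
          hd.fderivWithin (Omega_ud y (inner_mem hny))]
      rw [inner_smul_right, e, Real.norm_eq_abs]
      rw [show -2 * nn u y * (1/2) = -nn u y by ring, abs_neg, abs_of_nonneg hn]
    · have : gradient u y = 0 := by
        unfold gradient
        rw [fderiv_zero_of_not_differentiableAt hd, map_zero]
      rw [this]; simpa using hn
  · exact (nn_circ_cont hu).intervalIntegrable _ _

/-- Uniform bounds near the inner circle for solutions of (P) when `V` is Lipschitz with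
constant `≤ a / (2 (1 + 2^{2β}))`: the weighted volume on `C₂ = {1/2 < |x| < 3/4}` and the
flux `|∫_{C(1/2)} ∂_ν u dσ|` are bounded, where `ν(x) = -2x` on `C(1/2)`. -/
theorem inner_boundary_bounds_P (β a b : ℝ) (hβ : 0 < β ∧ β < 1/2) (ha : 0 < a) (hab : a ≤ b) :
    ∃ C > (0:ℝ), ∀ (x₀ : E2), ‖x₀‖ = 1/2 →
      ∀ V u : E2 → ℝ,
        LipschitzOnWith (Real.toNNReal (a / (2 * (1 + (2:ℝ) ^ (2 * β))))) V (closure Omega) →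
        (∀ x ∈ closure Omega, a ≤ V x ∧ V x ≤ b) →
        IsSolP β x₀ V u →
        (∫ x in ann (1/2) (3/4),
          (2 + 2 * (β + 1) * ‖x - x₀‖ ^ (2 * β)) * V x * Real.exp (u x)) ≤ C ∧
        |circleIntR (fun x => ⟪gradient u x, (-2 : ℝ) • x⟫) (1/2)| ≤ C := by
  obtain ⟨C1, C2, hC⟩ := core_est β a b hβ.1 ha hab
  refine ⟨max (max C1 C2) 1, lt_of_lt_of_le one_pos (le_max_right _ _), ?_⟩
  intro x₀ hx₀ V u hVL hVb hsol
  obtain ⟨hu, hbd, hPDE⟩ := hsol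
  have hpos : ∀ x ∈ Omega, 0 < -lap u x := by
    intro x hx
    rw [hPDE x hx]
    have h1 := (hVb x (subset_closure hx)).1
    have h2 : 0 < V x := by linarith
    have h3 : 0 ≤ ‖x - x₀‖ ^ (2 * β) := rpow_nonneg (norm_nonneg _) _
    positivity
  have h0 := sol_nonneg hu hbd hpos
  obtain ⟨ε0, hε0, hest⟩ := hC x₀ hx₀ V u hVL hVb ⟨hu, hbd, hPDE⟩ h0
  constructor
  · refine le_trans (shell_limit ?_ hε0 fun ε h1 h2 => (hest ε h1 h2).1)
      ((le_max_left _ _).trans (le_max_left _ _))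
    have kr : ContinuousOn (fun x : E2 => ‖x - x₀‖ ^ (2 * β)) (closure Omega) :=
      (rho_cont hβ.1 x₀).continuousOn
    have kV := hVL.continuousOn
    have ku := hu.continuousOn
    exact ((continuousOn_const.add (continuousOn_const.mul kr)).mul kV).mul ku.rexp
  · refine (flux_le hu hbd h0).trans ?_
    refine ((hest (ε0 / 2) (by linarith) (by linarith)).2).trans ?_
    exact (le_max_right _ _).trans (le_max_left _ _)
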